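/- arXiv:1204.5760 — 2 statements merged into one kernel-verified Lean document; each statement's English description precedes it below -/
import Mathlib

section
/- Assume conditions (C) and (P) hold and χ(0) < 0. Then for every bounded solution φ ≥ 0 of the convolution equation (17) the following dichotomy holds at +∞: either liminf_{t→+∞} φ(t) > 0 or lim_{t→+∞} φ(t) = 0. The analogous dichotomy holds at −∞: either liminf_{t→−∞} φ(t) > 0 or lim_{t→−∞} φ(t) = 0. -/
open MeasureTheory Filter Topology Set

/-- Translation is continuous in `L¹(ℝ)`. -/
theorem tendsto_integral_norm_translate_sub {f : ℝ → ℝ} (hf : Integrable f) :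
    Tendsto (fun h => ∫ s, ‖f (h + s) - f s‖) (𝓝 0) (𝓝 0) := by
  have hm := memLp_one_iff_integrable.2 hf
  have : Fact ((1 : ENNReal) ≠ ⊤) := ⟨ENNReal.one_ne_top⟩
  have hc : Continuous fun h : ℝ => DomAddAct.mk h +ᵥ hm.toLp f :=
    DomAddAct.continuous_mk.vadd continuous_const
  have h2 := (hc.tendsto 0).dist (tendsto_const_nhds (x := hm.toLp f))
  have h0 : DomAddAct.mk (0 : ℝ) +ᵥ hm.toLp f = hm.toLp f := by simp
  rw [h0, dist_self] at h2
  refine h2.congr fun h => ?_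
  rw [L1.dist_eq_integral_dist, DomAddAct.mk_vadd_toLp]
  refine integral_congr_ae ?_
  have hm' : MemLp (fun x => f (h +ᵥ x)) 1 volume :=
    hm.comp_measurePreserving (measurePreserving_vadd h volume)
  filter_upwards [MemLp.coeFn_toLp hm, MemLp.coeFn_toLp hm'] with s h1 h2
  rw [h1, h2, dist_eq_norm, vadd_eq_add]

section Convolution

variable {X : Type*} [MeasurableSpace X] {μ : Measure X} [SFinite μ]

theorem measurePreserving_prodMap_add_left (h : ℝ) :
    MeasurePreserving (fun p : ℝ × X => (h + p.1, p.2))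
      ((volume : Measure ℝ).prod μ) ((volume : Measure ℝ).prod μ) :=
  (measurePreserving_add_left volume h).prod (MeasurePreserving.id μ)

theorem measurePreserving_prodMap_sub_left (h : ℝ) :
    MeasurePreserving (fun p : ℝ × X => (h - p.1, p.2))
      ((volume : Measure ℝ).prod μ) ((volume : Measure ℝ).prod μ) :=
  (Measure.measurePreserving_sub_left volume h).prod (MeasurePreserving.id μ)

theorem integral_prod_comp_sub_left {f : ℝ × X → ℝ} (hf : Measurable f) (h : ℝ) :
    ∫ p, f (h - p.1, p.2) ∂((volume : Measure ℝ).prod μ)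
      = ∫ p, f p ∂((volume : Measure ℝ).prod μ) := by
  have hp := measurePreserving_prodMap_sub_left (μ := μ) h
  rw [← integral_map hp.measurable.aemeasurable hf.aestronglyMeasurable, hp.map_eq]

/-- Translation in the first variable is continuous in `L¹(ℝ × X)`. -/
theorem tendsto_integral_norm_translate_sub_prod {F : ℝ × X → ℝ}
    (hF : Integrable F ((volume : Measure ℝ).prod μ)) :
    Tendsto (fun h => ∫ p, ‖F (h + p.1, p.2) - F p‖ ∂((volume : Measure ℝ).prod μ))
      (𝓝 0) (𝓝 0) := by
  have hFt (h : ℝ) : Integrable (fun p : ℝ × X => F (h + p.1, p.2))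
      ((volume : Measure ℝ).prod μ) :=
    (measurePreserving_prodMap_add_left h).integrable_comp_of_integrable hF
  have hint (h : ℝ) : Integrable (fun p : ℝ × X => ‖F (h + p.1, p.2) - F p‖)
      ((volume : Measure ℝ).prod μ) := ((hFt h).sub hF).norm
  have key : Tendsto (fun h => ∫ τ, (∫ s, ‖F (h + s, τ) - F (s, τ)‖) ∂μ) (𝓝 0)
      (𝓝 (∫ _, (0 : ℝ) ∂μ)) := by
    refine tendsto_integral_filter_of_dominated_convergence
      (fun τ => 2 * ∫ s, ‖F (s, τ)‖) ?_ ?_ ?_ ?_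
    · exact Eventually.of_forall fun h => (hint h).integral_prod_right.aestronglyMeasurable
    · refine Eventually.of_forall fun h => ?_
      filter_upwards [hF.prod_left_ae] with τ hτ
      have hτ' : Integrable (fun s => F (h + s, τ)) := hτ.comp_add_left h
      rw [Real.norm_of_nonneg (integral_nonneg fun _ => norm_nonneg _)]
      calc ∫ s, ‖F (h + s, τ) - F (s, τ)‖ ≤ ∫ s, (‖F (h + s, τ)‖ + ‖F (s, τ)‖) :=
            integral_mono (hτ'.sub hτ).norm (hτ'.norm.add hτ.norm) fun s => norm_sub_le _ _
        _ = 2 * ∫ s, ‖F (s, τ)‖ := by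
            rw [integral_add hτ'.norm hτ.norm,
              integral_add_left_eq_self (fun s => ‖F (s, τ)‖) h, two_mul]
    · exact hF.norm.integral_prod_right.const_mul 2
    · filter_upwards [hF.prod_left_ae] with τ hτ
      exact tendsto_integral_norm_translate_sub hτ
  rw [integral_zero] at key
  exact key.congr fun h => (integral_prod_symm _ (hint h)).symm

/-- The convolution of an integrable kernel with a bounded density is uniformly continuous. -/
theorem uniformContinuous_integral_mul_sub {K w : ℝ → X → ℝ} {C : X → ℝ}
    (hK : Measurable fun p : ℝ × X => K p.1 p.2) (hw : Measurable fun p : ℝ × X => w p.1 p.2)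
    (hC : Measurable C) (hwC : ∀ s τ, |w s τ| ≤ C τ)
    (hKC : Integrable (fun p : ℝ × X => K p.1 p.2 * C p.2) ((volume : Measure ℝ).prod μ)) :
    UniformContinuous fun t =>
      ∫ p : ℝ × X, K p.1 p.2 * w (t - p.1) p.2 ∂((volume : Measure ℝ).prod μ) := by
  set F : ℝ × X → ℝ := fun p => K p.1 p.2 * C p.2 with hFdef
  have hFm : Measurable F := hK.mul (hC.comp measurable_snd)
  have hC0 (τ : X) : 0 ≤ C τ := (abs_nonneg _).trans (hwC 0 τ)
  have hm (t : ℝ) : Measurable fun p : ℝ × X => K (t - p.1) p.2 * w p.1 p.2 :=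
    (hK.comp ((measurable_const.sub measurable_fst).prodMk measurable_snd)).mul hw
  have hFt (t : ℝ) : Integrable (fun p : ℝ × X => F (t - p.1, p.2))
      ((volume : Measure ℝ).prod μ) :=
    (measurePreserving_prodMap_sub_left t).integrable_comp_of_integrable hKC
  have hint (t : ℝ) : Integrable (fun p : ℝ × X => K (t - p.1) p.2 * w p.1 p.2)
      ((volume : Measure ℝ).prod μ) := by
    refine (hFt t).mono (hm t).aestronglyMeasurable (Eventually.of_forall fun p => ?_)
    simp only [hFdef, Real.norm_eq_abs, abs_mul]
    exact mul_le_mul_of_nonneg_left ((hwC _ _).trans (le_abs_self _)) (abs_nonneg _)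
  have heq (t : ℝ) : ∫ p : ℝ × X, K p.1 p.2 * w (t - p.1) p.2 ∂((volume : Measure ℝ).prod μ)
      = ∫ p : ℝ × X, K (t - p.1) p.2 * w p.1 p.2 ∂((volume : Measure ℝ).prod μ) := by
    simpa using (integral_prod_comp_sub_left (μ := μ) (hm t) t)
  simp_rw [heq]
  have hbound (t t' : ℝ) :
      |(∫ p : ℝ × X, K (t - p.1) p.2 * w p.1 p.2 ∂((volume : Measure ℝ).prod μ))
        - ∫ p : ℝ × X, K (t' - p.1) p.2 * w p.1 p.2 ∂((volume : Measure ℝ).prod μ)|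
      ≤ ∫ p, ‖F ((t - t') + p.1, p.2) - F p‖ ∂((volume : Measure ℝ).prod μ) := by
    have hm' : Measurable fun p : ℝ × X => ‖F ((t - t') + p.1, p.2) - F p‖ :=
      ((hFm.comp ((measurable_const.add measurable_fst).prodMk measurable_snd)).sub hFm).norm
    rw [← integral_sub (hint t) (hint t'), ← integral_prod_comp_sub_left hm' t']
    refine (abs_integral_le_integral_abs).trans
      (integral_mono ((hint t).sub (hint t')).abs ?_ fun p => ?_)
    · have := ((hFt t).sub (hFt t')).norm
      simpa [sub_add_sub_cancel] using this
    · have h1 : t - t' + (t' - p.1) = t - p.1 := by ring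
      simp only [h1, hFdef, Real.norm_eq_abs]
      rw [← sub_mul, ← sub_mul, abs_mul, abs_mul]
      exact mul_le_mul_of_nonneg_left ((hwC _ _).trans (le_abs_self _)) (abs_nonneg _)
  have hlim := tendsto_integral_norm_translate_sub_prod (μ := μ) hKC
  rw [Metric.uniformContinuous_iff]
  intro ε hε
  obtain ⟨δ, hδ, h⟩ := Metric.eventually_nhds_iff.1 (hlim.eventually (gt_mem_nhds hε))
  refine ⟨δ, hδ, fun {a b} hab => ?_⟩
  rw [Real.dist_eq]
  refine (hbound a b).trans_lt (h ?_)
  simpa [Real.dist_eq] using hab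

end Convolution

/-- A bounded uniformly continuous function has pointwise convergent sequences of translates. -/
theorem UniformContinuous.exists_subseq_tendsto_translate {φ : ℝ → ℝ} (hφ : UniformContinuous φ)
    {M : ℝ} (hM : ∀ t, φ t ∈ Icc 0 M) (t : ℕ → ℝ) :
    ∃ σ : ℕ → ℕ, StrictMono σ ∧ ∃ ψ : ℝ → ℝ, Continuous ψ ∧
      ∀ x, Tendsto (fun n => φ (t (σ n) + x)) atTop (𝓝 (ψ x)) := by
  have hcomp : IsCompact (Set.pi univ fun _ : ℚ => Icc 0 M) :=
    isCompact_univ_pi fun _ => isCompact_Icc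
  obtain ⟨a, -, σ, hσ, ha⟩ := hcomp.tendsto_subseq
    (x := fun n (q : ℚ) => φ (t n + q)) fun n q _ => hM _
  rw [tendsto_pi_nhds] at ha
  have huc := Metric.uniformContinuous_iff.1 hφ
  have hcauchy (x : ℝ) : CauchySeq fun n => φ (t (σ n) + x) := by
    rw [Metric.cauchySeq_iff]
    intro ε hε
    obtain ⟨δ, hδ, h⟩ := huc (ε / 3) (by positivity)
    obtain ⟨q, hq1, hq2⟩ := exists_rat_btwn (show x < x + δ by linarith)
    have hq (n : ℕ) : dist (φ (t n + x)) (φ (t n + q)) < ε / 3 := by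
      apply h
      rw [dist_add_left, Real.dist_eq, abs_lt]
      constructor <;> linarith
    obtain ⟨N, hN⟩ := Metric.cauchySeq_iff.1 (ha q).cauchySeq (ε / 3) (by positivity)
    refine ⟨N, fun m hm n hn => ?_⟩
    have h1 : dist (φ (t (σ m) + q)) (φ (t (σ n) + q)) < ε / 3 := hN m hm n hn
    have h2 := hq (σ m)
    have h3 := hq (σ n)
    rw [dist_comm] at h3
    linarith [dist_triangle4 (φ (t (σ m) + x)) (φ (t (σ m) + q)) (φ (t (σ n) + q))
      (φ (t (σ n) + x))]
  choose ψ hψ using fun x => cauchySeq_tendsto_of_complete (hcauchy x)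
  refine ⟨σ, hσ, ψ, ?_, hψ⟩
  refine UniformContinuous.continuous (Metric.uniformContinuous_iff.2 fun ε hε => ?_)
  obtain ⟨δ, hδ, h⟩ := huc (ε / 2) (by positivity)
  refine ⟨δ, hδ, fun {x y} hxy => ?_⟩
  refine (le_of_tendsto ((hψ x).dist (hψ y)) (Eventually.of_forall fun n => ?_)).trans_lt
    (half_lt_self hε)
  exact (h (by rwa [dist_add_left])).le

section Equation

variable {X : Type*} [MeasurableSpace X] {μ : Measure X} {K g : ℝ → X → ℝ}
  {C : X → ℝ} {M : ℝ}

theorem measurable_comp_sub (hgmeas : Measurable fun p : ℝ × X => g p.1 p.2) {u : ℝ → ℝ}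
    (hu : Measurable u) (t : ℝ) : Measurable fun p : ℝ × X => g (u (t - p.1)) p.2 :=
  hgmeas.comp ((hu.comp (measurable_const.sub measurable_fst)).prodMk measurable_snd)

theorem integrable_mul_comp_sub
    (hKmeas : Measurable fun p : ℝ × X => K p.1 p.2) (hKnn : ∀ s τ, 0 ≤ K s τ)
    (hgmeas : Measurable fun p : ℝ × X => g p.1 p.2)
    (hgnn : ∀ u τ, 0 ≤ u → 0 ≤ g u τ)
    (hgC : ∀ τ, ∀ u ∈ Icc 0 M, g u τ ≤ C τ)
    (hKC : Integrable (fun p : ℝ × X => K p.1 p.2 * C p.2) ((volume : Measure ℝ).prod μ))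
    {u : ℝ → ℝ} (hu : Measurable u) (huM : ∀ t, u t ∈ Icc 0 M) (t : ℝ) :
    Integrable (fun p : ℝ × X => K p.1 p.2 * g (u (t - p.1)) p.2)
      ((volume : Measure ℝ).prod μ) := by
  refine hKC.mono' (hKmeas.mul (measurable_comp_sub hgmeas hu t)).aestronglyMeasurable
    (Eventually.of_forall fun p => ?_)
  rw [Real.norm_of_nonneg (mul_nonneg (hKnn _ _) (hgnn _ _ (huM _).1))]
  exact mul_le_mul_of_nonneg_left (hgC _ _ (huM _)) (hKnn _ _)

variable [SFinite μ]

theorem integrable_mul_of_integrable_mul_integral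
    (hKmeas : Measurable fun p : ℝ × X => K p.1 p.2) (hKnn : ∀ s τ, 0 ≤ K s τ)
    (hKpos : ∀ τ, 0 < ∫ s, K s τ) (hCm : Measurable C) (hC0 : ∀ τ, 0 ≤ C τ)
    (hC : Integrable (fun τ => C τ * ∫ s, K s τ) μ) :
    Integrable (fun p : ℝ × X => K p.1 p.2 * C p.2) ((volume : Measure ℝ).prod μ) := by
  have hm : Measurable fun p : ℝ × X => K p.1 p.2 * C p.2 :=
    hKmeas.mul (hCm.comp measurable_snd)
  rw [integrable_prod_iff' hm.aestronglyMeasurable]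
  refine ⟨Eventually.of_forall fun τ =>
    (Integrable.of_integral_ne_zero (hKpos τ).ne').mul_const (C τ), hC.congr ?_⟩
  refine Eventually.of_forall fun τ => ?_
  simp only [norm_mul, Real.norm_of_nonneg (hKnn _ _), Real.norm_of_nonneg (hC0 τ)]
  rw [integral_mul_const, mul_comm]

/-- The nonlinear convolution operator is continuous along bounded pointwise convergent
sequences. -/
theorem tendsto_integral_mul_comp_sub
    (hKmeas : Measurable fun p : ℝ × X => K p.1 p.2) (hKnn : ∀ s τ, 0 ≤ K s τ)
    (hgmeas : Measurable fun p : ℝ × X => g p.1 p.2)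
    (hgnn : ∀ u τ, 0 ≤ u → 0 ≤ g u τ)
    (hgcont : ∀ τ, ContinuousOn (fun u => g u τ) (Ici 0))
    (hgC : ∀ τ, ∀ u ∈ Icc 0 M, g u τ ≤ C τ)
    (hKC : Integrable (fun p : ℝ × X => K p.1 p.2 * C p.2) ((volume : Measure ℝ).prod μ))
    {u : ℕ → ℝ → ℝ} {v : ℝ → ℝ} (hu : ∀ n, Measurable (u n)) (huM : ∀ n t, u n t ∈ Icc 0 M)
    (huv : ∀ x, Tendsto (fun n => u n x) atTop (𝓝 (v x))) (t : ℝ) :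
    Tendsto (fun n => ∫ τ, (∫ s, K s τ * g (u n (t - s)) τ) ∂μ) atTop
      (𝓝 (∫ τ, (∫ s, K s τ * g (v (t - s)) τ) ∂μ)) := by
  have hv : Measurable v := measurable_of_tendsto_metrizable hu (tendsto_pi_nhds.2 huv)
  have hvM (x : ℝ) : v x ∈ Icc 0 M :=
    isClosed_Icc.mem_of_tendsto (huv x) (Eventually.of_forall fun n => huM n x)
  have key := tendsto_integral_of_dominated_convergence
    (μ := (volume : Measure ℝ).prod μ)
    (F := fun n (p : ℝ × X) => K p.1 p.2 * g (u n (t - p.1)) p.2)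
    (f := fun p : ℝ × X => K p.1 p.2 * g (v (t - p.1)) p.2)
    (fun p => K p.1 p.2 * C p.2)
    (fun n => (hKmeas.mul (measurable_comp_sub hgmeas (hu n) t)).aestronglyMeasurable) hKC
    (fun n => Eventually.of_forall fun p => by
      rw [Real.norm_of_nonneg (mul_nonneg (hKnn _ _) (hgnn _ _ (huM _ _).1))]
      exact mul_le_mul_of_nonneg_left (hgC _ _ (huM _ _)) (hKnn _ _))
    (Eventually.of_forall fun p => by
      refine Tendsto.const_mul _ ?_
      exact ((hgcont p.2) _ (hvM (t - p.1)).1).tendsto.comp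
        (tendsto_nhdsWithin_iff.2 ⟨huv _, Eventually.of_forall fun n => (huM n _).1⟩))
  rw [integral_prod_symm _ (integrable_mul_comp_sub hKmeas hKnn hgmeas hgnn hgC hKC hv hvM t)]
    at key
  exact key.congr fun n => integral_prod_symm _
    (integrable_mul_comp_sub hKmeas hKnn hgmeas hgnn hgC hKC (hu n) (huM n) t)

theorem uniformContinuous_of_convolution_eq
    (hKmeas : Measurable fun p : ℝ × X => K p.1 p.2) (hKnn : ∀ s τ, 0 ≤ K s τ)
    (hgmeas : Measurable fun p : ℝ × X => g p.1 p.2)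
    (hgnn : ∀ u τ, 0 ≤ u → 0 ≤ g u τ) (hCm : Measurable C)
    (hgC : ∀ τ, ∀ u ∈ Icc 0 M, g u τ ≤ C τ)
    (hKC : Integrable (fun p : ℝ × X => K p.1 p.2 * C p.2) ((volume : Measure ℝ).prod μ))
    {φ : ℝ → ℝ} (hφ : Measurable φ) (hφM : ∀ t, φ t ∈ Icc 0 M)
    (hφeq : ∀ t, φ t = ∫ τ, (∫ s, K s τ * g (φ (t - s)) τ) ∂μ) :
    UniformContinuous φ := by
  have h := uniformContinuous_integral_mul_sub (μ := μ) (w := fun s τ => g (φ s) τ) hKmeas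
    (hgmeas.comp ((hφ.comp measurable_fst).prodMk measurable_snd)) hCm
    (fun s τ => by
      rw [abs_of_nonneg (hgnn _ _ (hφM s).1)]
      exact hgC τ _ (hφM s)) hKC
  convert h using 2 with t
  rw [hφeq t, integral_prod_symm _
    (integrable_mul_comp_sub hKmeas hKnn hgmeas hgnn hgC hKC hφ hφM t)]

/-- If every bounded nonnegative solution with a zero vanishes, then a bounded solution which is
small at a point is uniformly small on a long interval around it. -/
theorem exists_forall_lt_of_convolution_eq
    (hKmeas : Measurable fun p : ℝ × X => K p.1 p.2) (hKnn : ∀ s τ, 0 ≤ K s τ)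
    (hgmeas : Measurable fun p : ℝ × X => g p.1 p.2)
    (hgnn : ∀ u τ, 0 ≤ u → 0 ≤ g u τ)
    (hgcont : ∀ τ, ContinuousOn (fun u => g u τ) (Ici 0)) (hCm : Measurable C)
    (hgC : ∀ τ, ∀ u ∈ Icc 0 M, g u τ ≤ C τ)
    (hKC : Integrable (fun p : ℝ × X => K p.1 p.2 * C p.2) ((volume : Measure ℝ).prod μ))
    (hP : ∀ ψ : ℝ → ℝ, Continuous ψ → (∀ t, 0 ≤ ψ t) → (∃ M, ∀ t, ψ t ≤ M) →
      (∀ t, ψ t = ∫ τ, (∫ s, K s τ * g (ψ (t - s)) τ) ∂μ) →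
      (∃ t0, ψ t0 = 0) → ∀ t, ψ t = 0)
    {φ : ℝ → ℝ} (hφ : Measurable φ) (hφM : ∀ t, φ t ∈ Icc 0 M)
    (hφeq : ∀ t, φ t = ∫ τ, (∫ s, K s τ * g (φ (t - s)) τ) ∂μ)
    {η : ℝ} (hη : 0 < η) (R : ℝ) :
    ∃ δ > 0, ∀ t, φ t < δ → ∀ s, |s| ≤ R → φ (t + s) < η := by
  have huc := uniformContinuous_of_convolution_eq hKmeas hKnn hgmeas hgnn hCm hgC hKC hφ hφM hφeq
  by_contra! hcon
  choose t ht s hsR hs using fun n : ℕ => hcon (1 / ((n : ℝ) + 1)) (by positivity)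
  obtain ⟨σ, hσ, ψ, hψc, hψ⟩ := huc.exists_subseq_tendsto_translate hφM t
  have hψM (x : ℝ) : ψ x ∈ Icc 0 M :=
    isClosed_Icc.mem_of_tendsto (hψ x) (Eventually.of_forall fun n => hφM _)
  have hψeq (x : ℝ) : ψ x = ∫ τ, (∫ s, K s τ * g (ψ (x - s)) τ) ∂μ := by
    refine tendsto_nhds_unique (hψ x) ?_
    have := tendsto_integral_mul_comp_sub hKmeas hKnn hgmeas hgnn hgcont hgC hKC
      (u := fun n y => φ (t (σ n) + y)) (fun n => hφ.comp (measurable_const_add _))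
      (fun n y => hφM _) hψ x
    refine this.congr fun n => ?_
    rw [hφeq (t (σ n) + x)]
    simp only [add_sub_assoc]
  have hψ0 : ψ 0 = 0 := by
    refine tendsto_nhds_unique (hψ 0) (squeeze_zero (fun n => (hφM _).1) (fun n => ?_)
      (tendsto_one_div_add_atTop_nhds_zero_nat.comp hσ.tendsto_atTop))
    simpa using (ht (σ n)).le
  have hψz := hP ψ hψc (fun x => (hψM x).1) ⟨M, fun x => (hψM x).2⟩ hψeq ⟨0, hψ0⟩
  obtain ⟨b, -, ρ, hρ, hb⟩ := (isCompact_Icc (a := -R) (b := R)).tendsto_subseq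
    (x := fun n => s (σ n)) fun n => abs_le.1 (hsR (σ n))
  have h1 : Tendsto (fun n => dist (φ (t (σ (ρ n)) + s (σ (ρ n)))) (φ (t (σ (ρ n)) + b)))
      atTop (𝓝 0) := by
    rw [Metric.uniformContinuous_iff] at huc
    refine Metric.tendsto_atTop.2 fun ε hε => ?_
    obtain ⟨δ, hδ, h⟩ := huc ε hε
    obtain ⟨N, hN⟩ := Metric.tendsto_atTop.1 hb δ hδ
    refine ⟨N, fun n hn => ?_⟩
    rw [Real.dist_0_eq_abs, abs_of_nonneg dist_nonneg]
    exact h (by rw [dist_add_left]; exact hN n hn)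
  have h2 := h1.add ((hψ b).comp hρ.tendsto_atTop)
  rw [hψz b, add_zero] at h2
  refine hη.not_ge (ge_of_tendsto h2 (Eventually.of_forall fun n => ?_))
  have h3 := hs (σ (ρ n))
  have h4 := le_abs_self (φ (t (σ (ρ n)) + s (σ (ρ n))) - φ (t (σ (ρ n)) + b))
  simp only [Function.comp_apply, Real.dist_eq]
  linarith

/-- If the linearization at zero has mass larger than one, a positive bounded solution has no
small minima over long windows. -/
theorem not_forall_exists_window_min
    (hKmeas : Measurable fun p : ℝ × X => K p.1 p.2) (hKnn : ∀ s τ, 0 ≤ K s τ)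
    (hgmeas : Measurable fun p : ℝ × X => g p.1 p.2)
    (hgnn : ∀ u τ, 0 ≤ u → 0 ≤ g u τ)
    (hC0 : ∀ τ, 0 ≤ C τ)
    (hgC : ∀ τ, ∀ u ∈ Icc 0 M, g u τ ≤ C τ * u)
    (hKC : Integrable (fun p : ℝ × X => K p.1 p.2 * C p.2) ((volume : Measure ℝ).prod μ))
    {g' : X → ℝ} (hg'lim : ∀ τ, Tendsto (fun u => g u τ / u) (𝓝[>] 0) (𝓝 (g' τ)))
    (hχ0int : Integrable (fun p : ℝ × X => K p.1 p.2 * g' p.2) ((volume : Measure ℝ).prod μ))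
    (hχ0 : 1 < ∫ τ, (∫ s, K s τ * g' τ) ∂μ)
    {φ : ℝ → ℝ} (hφ : Measurable φ) (hφpos : ∀ t, 0 < φ t) (hφM : ∀ t, φ t ≤ M)
    (hφeq : ∀ t, φ t = ∫ τ, (∫ s, K s τ * g (φ (t - s)) τ) ∂μ) :
    ¬ ∀ n : ℕ, ∃ t, ∀ s : ℝ, |s| ≤ n → φ t ≤ φ (t + s) ∧ φ (t + s) < 1 / ((n : ℝ) + 1) := by
  intro h
  choose t ht using h
  have hφM' (x : ℝ) : φ x ∈ Icc 0 M := ⟨(hφpos x).le, hφM x⟩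
  set A : ℕ → Set (ℝ × X) := fun n => {p | |p.1| ≤ n} with hA
  have hAm (n : ℕ) : MeasurableSet (A n) :=
    measurableSet_le (measurable_fst.abs) measurable_const
  set f : ℕ → ℝ × X → ℝ := fun n => (A n).indicator fun p =>
    K p.1 p.2 * (g (φ (t n - p.1)) p.2 / φ (t n - p.1)) with hf
  have hq0 (x : ℝ) (τ : X) : 0 ≤ g (φ x) τ / φ x :=
    div_nonneg (hgnn _ _ (hφpos x).le) (hφpos x).le
  have hfm (n : ℕ) : Measurable (f n) :=
    (hKmeas.mul ((measurable_comp_sub hgmeas hφ (t n)).div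
      (hφ.comp (measurable_const.sub measurable_fst)))).indicator (hAm n)
  have hfC (n : ℕ) (p : ℝ × X) : ‖f n p‖ ≤ K p.1 p.2 * C p.2 := by
    refine (norm_indicator_le_norm_self _ _).trans ?_
    rw [Real.norm_of_nonneg (mul_nonneg (hKnn _ _) (hq0 _ _))]
    refine mul_le_mul_of_nonneg_left ?_ (hKnn _ _)
    rw [div_le_iff₀ (hφpos _)]
    exact hgC _ _ (hφM' _)
  have hlim := tendsto_integral_of_dominated_convergence (μ := (volume : Measure ℝ).prod μ)
    (F := f) (f := fun p => K p.1 p.2 * g' p.2) (fun p => K p.1 p.2 * C p.2)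
    (fun n => (hfm n).aestronglyMeasurable) hKC
    (fun n => Eventually.of_forall (hfC n))
    (Eventually.of_forall fun p => by
      have hev : ∀ᶠ n : ℕ in atTop, |p.1| ≤ n :=
        tendsto_natCast_atTop_atTop.eventually_ge_atTop _
      have hφ0 : Tendsto (fun n => φ (t n - p.1)) atTop (𝓝[>] 0) := by
        refine tendsto_nhdsWithin_iff.2 ⟨?_, Eventually.of_forall fun n => hφpos _⟩
        refine squeeze_zero' (Eventually.of_forall fun n => (hφpos _).le) ?_
          tendsto_one_div_add_atTop_nhds_zero_nat
        filter_upwards [hev] with n hn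
        have := (ht n (-p.1) (by rwa [abs_neg])).2
        rw [← sub_eq_add_neg] at this
        exact this.le
      refine (((hg'lim p.2).comp hφ0).const_mul (K p.1 p.2)).congr' ?_
      filter_upwards [hev] with n hn
      have hp : p ∈ A n := hn
      simp only [hf, indicator_of_mem hp, Function.comp_apply])
  rw [integral_prod_symm _ hχ0int] at hlim
  refine hχ0.not_ge (le_of_tendsto hlim (Eventually.of_forall fun n => ?_))
  have hgCM (τ : X) (u : ℝ) (hu : u ∈ Icc 0 M) : g u τ ≤ M * C τ :=
    (hgC τ u hu).trans (by rw [mul_comm]; exact mul_le_mul_of_nonneg_right hu.2 (hC0 τ))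
  have hKC' : Integrable (fun p : ℝ × X => K p.1 p.2 * (M * C p.2))
      ((volume : Measure ℝ).prod μ) :=
    (hKC.const_mul M).congr (Eventually.of_forall fun p => by ring)
  have hint := integrable_mul_comp_sub hKmeas hKnn hgmeas hgnn hgCM hKC' hφ hφM' (t n)
  have hfi : Integrable (f n) ((volume : Measure ℝ).prod μ) :=
    hKC.mono' (hfm n).aestronglyMeasurable (Eventually.of_forall (hfC n))
  have hle : φ (t n) * ∫ p, f n p ∂((volume : Measure ℝ).prod μ) ≤ φ (t n) := by
    conv_rhs => rw [hφeq (t n), ← integral_prod_symm _ hint]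
    rw [← integral_const_mul]
    refine integral_mono (hfi.const_mul _) hint fun p => ?_
    have h0 := mul_nonneg (hKnn p.1 p.2) (hgnn _ p.2 (hφpos (t n - p.1)).le)
    by_cases hp : p ∈ A n
    · simp only [hf, indicator_of_mem hp]
      have h1 := (ht n (-p.1) (by rw [abs_neg]; exact hp)).1
      rw [← sub_eq_add_neg] at h1
      calc φ (t n) * (K p.1 p.2 * (g (φ (t n - p.1)) p.2 / φ (t n - p.1)))
          ≤ φ (t n - p.1) * (K p.1 p.2 * (g (φ (t n - p.1)) p.2 / φ (t n - p.1))) :=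
            mul_le_mul_of_nonneg_right h1 (mul_nonneg (hKnn _ _) (hq0 _ _))
        _ = K p.1 p.2 * g (φ (t n - p.1)) p.2 := by
            have := (hφpos (t n - p.1)).ne'
            field_simp
    · simpa only [hf, indicator_of_notMem hp, mul_zero] using h0
  nlinarith [hφpos (t n)]

end Equation

theorem pos_liminf_or_tendsto_zero {l : Filter ℝ} [l.NeBot] {φ : ℝ → ℝ} {M : ℝ}
    (hφnn : ∀ t, 0 ≤ φ t) (hφM : ∀ t, φ t ≤ M)
    (h : ∀ a > 0, ¬ ((∃ᶠ t in l, a ≤ φ t) ∧ ∀ δ > 0, ∃ᶠ t in l, φ t < δ)) :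
    0 < liminf φ l ∨ Tendsto φ l (𝓝 0) := by
  by_contra! hcon
  obtain ⟨h1, h2⟩ := hcon
  rw [Metric.tendsto_nhds] at h2
  push Not at h2
  obtain ⟨a, ha, h2⟩ := h2
  refine h a ha ⟨h2.mono fun t ht => ?_, fun δ hδ => ?_⟩
  · simpa [Real.dist_eq, abs_of_nonneg (hφnn t)] using ht
  · have hcob : IsCoboundedUnder (· ≥ ·) l φ :=
      (isBoundedUnder_of ⟨M, hφM⟩ : IsBoundedUnder (· ≤ ·) l φ).isCoboundedUnder_ge
    exact frequently_lt_of_liminf_lt hcob (h1.trans_lt hδ)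

theorem stmt2
    {X : Type*} [MeasurableSpace X] (μ : Measure X) [IsFiniteMeasure μ]
    (K : ℝ → X → ℝ) (g : ℝ → X → ℝ)
    (hKmeas : Measurable fun p : ℝ × X => K p.1 p.2)
    (hKnn : ∀ s τ, 0 ≤ K s τ)
    (hKint : Integrable (fun p : ℝ × X => K p.1 p.2) ((volume : Measure ℝ).prod μ))
    (hKpos : ∀ τ, 0 < ∫ s, K s τ)
    (hgmeas : Measurable fun p : ℝ × X => g p.1 p.2)
    (hg0 : ∀ τ, g 0 τ = 0)
    (hgnn : ∀ u τ, 0 ≤ u → 0 ≤ g u τ)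
    (hgcont : ∀ τ, ContinuousOn (fun u => g u τ) (Ici 0))
    (g' : X → ℝ) (hg'meas : Measurable g') (hg'pos : ∀ τ, 0 < g' τ)
    (hg'lim : ∀ τ, Tendsto (fun u => g u τ / u) (𝓝[>] 0) (𝓝 (g' τ)))
    (hC : ∀ δ : ℝ, 0 < δ → ∃ Cd : X → ℝ, Measurable Cd ∧ (∀ τ, 0 ≤ Cd τ) ∧
      (∀ τ, ∀ u ∈ Icc (0:ℝ) δ, g u τ ≤ Cd τ * u) ∧
      Integrable (fun τ => Cd τ * ∫ s, K s τ) μ)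
    (hP : ∀ ψ : ℝ → ℝ, Continuous ψ → (∀ t, 0 ≤ ψ t) → (∃ M, ∀ t, ψ t ≤ M) →
      (∀ t, ψ t = ∫ τ, (∫ s, K s τ * g (ψ (t - s)) τ) ∂μ) →
      (∃ t0, ψ t0 = 0) → ∀ t, ψ t = 0)
    (hχ0int : Integrable (fun p : ℝ × X => K p.1 p.2 * g' p.2) ((volume : Measure ℝ).prod μ))
    (hχ0 : 1 < ∫ τ, (∫ s, K s τ * g' τ) ∂μ)
    (φ : ℝ → ℝ) (hφc : Continuous φ)
    (hφnn : ∀ t, 0 ≤ φ t)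
    (hφbd : ∃ M, ∀ t, φ t ≤ M)
    (hφeq : ∀ t, φ t = ∫ τ, (∫ s, K s τ * g (φ (t - s)) τ) ∂μ)
    :
    (0 < liminf φ atTop ∨ Tendsto φ atTop (𝓝 0)) ∧
    (0 < liminf φ atBot ∨ Tendsto φ atBot (𝓝 0)) := by
  obtain ⟨M₀, hM₀⟩ := hφbd
  set M := max M₀ 1
  have hM : 0 < M := lt_max_of_lt_right one_pos
  have hφM (t : ℝ) : φ t ≤ M := (hM₀ t).trans (le_max_left _ _)
  have hφI (t : ℝ) : φ t ∈ Icc 0 M := ⟨hφnn t, hφM t⟩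
  by_cases hz : ∃ t, φ t = 0
  · have h0 : φ = fun _ => 0 := funext (hP φ hφc hφnn ⟨M, hφM⟩ hφeq hz)
    exact ⟨.inr (h0 ▸ tendsto_const_nhds), .inr (h0 ▸ tendsto_const_nhds)⟩
  have hφpos (t : ℝ) : 0 < φ t := (hφnn t).lt_of_ne fun h => hz ⟨t, h.symm⟩
  obtain ⟨C, hCm, hC0, hgC, hCint⟩ := hC M hM
  have hKC := integrable_mul_of_integrable_mul_integral hKmeas hKnn hKpos hCm hC0 hCint
  have hKC' : Integrable (fun p : ℝ × X => K p.1 p.2 * (M * C p.2))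
      ((volume : Measure ℝ).prod μ) :=
    (hKC.const_mul M).congr (Eventually.of_forall fun p => by ring)
  have hgCM (τ : X) (u : ℝ) (hu : u ∈ Icc 0 M) : g u τ ≤ M * C τ :=
    (hgC τ u hu).trans (by rw [mul_comm]; exact mul_le_mul_of_nonneg_right hu.2 (hC0 τ))
  have valley (a : ℝ) (ha : 0 < a)
      (h : ∀ δ > 0, ∃ p t q, p ≤ t ∧ t ≤ q ∧ a ≤ φ p ∧ a ≤ φ q ∧ φ t < δ) : False := by
    refine not_forall_exists_window_min hKmeas hKnn hgmeas hgnn hC0 hgC hKC hg'lim hχ0int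
      hχ0 hφc.measurable hφpos hφM hφeq fun n => ?_
    obtain ⟨δ, hδ, hsmall⟩ := exists_forall_lt_of_convolution_eq hKmeas hKnn hgmeas hgnn hgcont
      (hCm.const_mul M) hgCM hKC' hP hφc.measurable hφI hφeq
      (η := min a (1 / ((n : ℝ) + 1))) (lt_min ha (by positivity)) n
    obtain ⟨p, t, q, hpt, htq, hp, hq, ht⟩ := h δ hδ
    obtain ⟨m, ⟨hpm, hmq⟩, hm⟩ := isCompact_Icc.exists_isMinOn
      (nonempty_Icc.2 (hpt.trans htq)) hφc.continuousOn
    have hwin := hsmall m ((hm ⟨hpt, htq⟩ : φ m ≤ φ t).trans_lt ht)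
    have hout (x : ℝ) (hx : a ≤ φ x) : (n : ℝ) < |x - m| := by
      by_contra! hxm
      have := (hwin (x - m) hxm).trans_le (min_le_left _ _)
      rw [add_sub_cancel] at this
      exact this.not_ge hx
    have hp' := hout p hp
    have hq' := hout q hq
    rw [abs_of_nonpos (by linarith)] at hp'
    rw [abs_of_nonneg (by linarith)] at hq'
    refine ⟨m, fun s hs => ⟨hm ⟨?_, ?_⟩, (hwin s hs).trans_le (min_le_right _ _)⟩⟩ <;>
      linarith [(abs_le.1 hs).1, (abs_le.1 hs).2]
  constructor
  · refine pos_liminf_or_tendsto_zero hφnn hφM fun a ha ⟨hbig, hsmall⟩ => valley a ha fun δ hδ => ?_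
    obtain ⟨p, -, hp⟩ := frequently_atTop.1 hbig 0
    obtain ⟨t, hpt, ht⟩ := frequently_atTop.1 (hsmall δ hδ) p
    obtain ⟨q, htq, hq⟩ := frequently_atTop.1 hbig t
    exact ⟨p, t, q, hpt, htq, hp, hq, ht⟩
  · refine pos_liminf_or_tendsto_zero hφnn hφM fun a ha ⟨hbig, hsmall⟩ => valley a ha fun δ hδ => ?_
    obtain ⟨q, -, hq⟩ := frequently_atBot.1 hbig 0
    obtain ⟨t, htq, ht⟩ := frequently_atBot.1 (hsmall δ hδ) q
    obtain ⟨p, hpt, hp⟩ := frequently_atBot.1 hbig t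
    exact ⟨p, t, q, hpt, htq, hp, hq, ht⟩
end

section
/- Assume conditions (C) and (P) hold and χ(0) < 0. If χ has no zero z > 0 (on its domain of finiteness), then every positive bounded solution φ of the convolution equation (17) satisfies liminf_{t→−∞} φ(t) > 0; if χ has no zero z < 0, then every positive bounded solution φ satisfies liminf_{t→+∞} φ(t) > 0. Consequently, equation (17) has no positive bounded pulse solution, i.e., no positive bounded solution φ with lim_{t→−∞} φ(t) = 0 and lim_{t→+∞} φ(t) = 0. -/
open MeasureTheory Filter Topology Set

theorem tendsto_integral_abs_translate_sub {f : ℝ → ℝ} (hf : Integrable f) :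
    Tendsto (fun d => ∫ s, |f (s + d) - f s|) (𝓝 0) (𝓝 0) := by
  rw [Metric.tendsto_nhds]
  intro e he
  obtain ⟨v, hvs, hvf, hvc, hvi⟩ :=
    hf.exists_hasCompactSupport_integral_sub_le (show 0 < e / 3 by positivity)
  have hlim : Tendsto (fun d => ∫ s, |v (s + d) - v s|) (𝓝 0) (𝓝 (∫ _ : ℝ, (0 : ℝ))) := by
    obtain ⟨C, hC⟩ := hvs.exists_bound_of_continuous hvc
    obtain ⟨r, hr⟩ := hvs.isCompact.isBounded.subset_closedBall 0
    have hv0 : ∀ x, r < |x| → v x = 0 := fun x hx => by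
      by_contra h
      have := hr (subset_tsupport v h)
      rw [Metric.mem_closedBall, Real.dist_eq, sub_zero] at this
      linarith
    refine tendsto_integral_filter_of_dominated_convergence
      ((Metric.closedBall (0 : ℝ) (r + 1)).indicator fun _ => C + C) ?_ ?_ ?_ ?_
    · exact Eventually.of_forall fun d => Continuous.aestronglyMeasurable (by fun_prop)
    · filter_upwards [Metric.closedBall_mem_nhds (0 : ℝ) one_pos] with d hd
      refine Eventually.of_forall fun s => ?_
      rw [Metric.mem_closedBall, Real.dist_eq, sub_zero] at hd
      rw [Real.norm_eq_abs, abs_abs]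
      by_cases hs : s ∈ Metric.closedBall (0 : ℝ) (r + 1)
      · rw [indicator_of_mem hs]
        exact (abs_sub _ _).trans (add_le_add (hC _) (hC _))
      · rw [indicator_of_notMem hs]
        rw [Metric.mem_closedBall, Real.dist_eq, sub_zero, not_le] at hs
        have : |s| ≤ |s + d| + |d| := by simpa using abs_sub (s + d) d
        rw [hv0 s (by linarith), hv0 (s + d) (by linarith)]
        simp
    · rw [integrable_indicator_iff Metric.isClosed_closedBall.measurableSet]
      exact integrableOn_const measure_closedBall_lt_top.ne
    · refine Eventually.of_forall fun s => ?_
      have : Continuous fun d => |v (s + d) - v s| := by fun_prop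
      simpa using this.tendsto 0
  rw [integral_zero, Metric.tendsto_nhds] at hlim
  filter_upwards [hlim (e / 3) (by positivity)] with d hd
  rw [Real.dist_eq, sub_zero, abs_of_nonneg (integral_nonneg fun _ => abs_nonneg _)] at hd ⊢
  have hfv : Integrable fun s => |f s - v s| := (hf.sub hvi).abs
  have hfvd : Integrable fun s => |f (s + d) - v (s + d)| := hfv.comp_add_right d
  have hvv : Integrable fun s => |v (s + d) - v s| := ((hvi.comp_add_right d).sub hvi).abs
  have hsum : Integrable fun s => |f (s + d) - v (s + d)| + |v (s + d) - v s| := hfvd.add hvv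
  have heq : ∫ s, |f (s + d) - v (s + d)| = ∫ s, |f s - v s| :=
    integral_add_right_eq_self (fun s => |f s - v s|) d
  have hvf' : ∫ s, |f s - v s| ≤ e / 3 := hvf
  calc ∫ s, |f (s + d) - f s|
      ≤ ∫ s, (|f (s + d) - v (s + d)| + |v (s + d) - v s| + |f s - v s|) := by
        refine integral_mono ((hf.comp_add_right d).sub hf).abs (hsum.add hfv)
          fun s => ?_
        have h1 := abs_sub_le (f (s + d)) (v (s + d)) (f s)
        have h2 := abs_sub_le (v (s + d)) (v s) (f s)
        rw [abs_sub_comm (v s) (f s)] at h2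
        dsimp only
        linarith
    _ = (∫ s, |f (s + d) - v (s + d)|) + (∫ s, |v (s + d) - v s|) + ∫ s, |f s - v s| := by
        rw [integral_add hsum hfv, integral_add hfvd hvv]
    _ < e := by linarith

theorem exists_subseq_translates_tendsto {φ : ℝ → ℝ} (hφ : UniformContinuous φ) {M : ℝ}
    (hφM : ∀ t, φ t ∈ Icc 0 M) (a : ℕ → ℝ) :
    ∃ (ψ : ℝ → ℝ) (n : ℕ → ℕ), StrictMono n ∧ UniformContinuous ψ ∧
      ∀ t, Tendsto (fun j => φ (t + a (n j))) atTop (𝓝 (ψ t)) := by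
  have hcomp : IsCompact (univ.pi fun _ : ℚ => Icc (0 : ℝ) M) :=
    isCompact_univ_pi fun _ => isCompact_Icc
  obtain ⟨u, -, n, hn, hu⟩ := hcomp.tendsto_subseq (x := fun j (p : ℚ) => φ (p + a j))
    fun j p _ => hφM _
  have hu' : ∀ p : ℚ, Tendsto (fun j => φ (p + a (n j))) atTop (𝓝 (u p)) :=
    fun p => tendsto_pi_nhds.1 hu p
  have huc := Metric.uniformContinuous_iff.1 hφ
  have hlim : ∀ t : ℝ, ∃ y, Tendsto (fun j => φ (t + a (n j))) atTop (𝓝 y) := by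
    intro t
    refine cauchySeq_tendsto_of_complete (Metric.cauchySeq_iff'.2 fun e he => ?_)
    obtain ⟨d, hd, hdφ⟩ := huc (e / 3) (by positivity)
    obtain ⟨p, hp⟩ := Rat.denseRange_cast.exists_dist_lt t hd
    obtain ⟨N, hN⟩ := Metric.cauchySeq_iff'.1 (hu' p).cauchySeq (e / 3) (by positivity)
    refine ⟨N, fun j hj => ?_⟩
    have h1 : ∀ j, dist (φ (t + a (n j))) (φ (p + a (n j))) < e / 3 :=
      fun j => hdφ (by rwa [dist_add_right])
    have h2 := h1 N
    rw [dist_comm] at h2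
    have h3 := dist_triangle4 (φ (t + a (n j))) (φ (p + a (n j))) (φ (p + a (n N)))
      (φ (t + a (n N)))
    linarith [h1 j, hN j hj]
  choose ψ hψ using hlim
  refine ⟨ψ, n, hn, Metric.uniformContinuous_iff.2 fun e he => ?_, hψ⟩
  obtain ⟨d, hd, hdφ⟩ := huc (e / 2) (by positivity)
  refine ⟨d, hd, fun {x y} hxy => ?_⟩
  have := le_of_tendsto' ((hψ x).dist (hψ y)) fun j => (hdφ (by rwa [dist_add_right])).le
  linarith

theorem tendsto_translates_of_tendsto {φ : ℝ → ℝ} (hφ : UniformContinuous φ) {a x : ℕ → ℝ}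
    {y c : ℝ} (ha : Tendsto (fun j => φ (c + a j)) atTop (𝓝 y)) (hx : Tendsto x atTop (𝓝 c)) :
    Tendsto (fun j => φ (x j + a j)) atTop (𝓝 y) := by
  refine tendsto_of_tendsto_of_dist ha (Metric.tendsto_nhds.2 fun e he => ?_)
  obtain ⟨d, hd, hdφ⟩ := Metric.uniformContinuous_iff.1 hφ e he
  filter_upwards [Metric.tendsto_nhds.1 hx d hd] with j hj
  rw [Real.dist_eq, sub_zero, abs_of_nonneg dist_nonneg]
  exact hdφ (by rwa [dist_add_right, dist_comm])

/-- The reaction term `g` is dominated by `B` on `[0, M]`, and `B` is integrable against the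
kernel `K`. -/
structure IsDominatedReaction {X : Type*} [MeasurableSpace X] (μ : Measure X) (K g : ℝ → X → ℝ)
    (M : ℝ) (B : X → ℝ) : Prop where
  measurable_kernel : Measurable fun p : ℝ × X => K p.1 p.2
  kernel_nonneg : ∀ s τ, 0 ≤ K s τ
  integral_kernel_pos : ∀ τ, 0 < ∫ s, K s τ
  measurable_reaction : Measurable fun p : ℝ × X => g p.1 p.2
  reaction_mem : ∀ τ, ∀ u ∈ Icc 0 M, g u τ ∈ Icc 0 (B τ)
  bound_nonneg : ∀ τ, 0 ≤ B τ
  measurable_bound : Measurable B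
  integrable_bound : Integrable (fun τ => B τ * ∫ s, K s τ) μ

namespace IsDominatedReaction

variable {X : Type*} [MeasurableSpace X] {μ : Measure X} {K g : ℝ → X → ℝ} {M : ℝ} {B : X → ℝ}

theorem integrable_kernel (h : IsDominatedReaction μ K g M B) (τ : X) :
    Integrable fun s => K s τ := by
  by_contra hK
  have := h.integral_kernel_pos τ
  rw [integral_undef hK] at this
  exact lt_irrefl _ this

theorem measurable_mul (h : IsDominatedReaction μ K g M B) {v : ℝ → ℝ} (hv : Measurable v) :
    Measurable fun p : ℝ × X => K p.1 p.2 * g (v p.1) p.2 :=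
  h.measurable_kernel.mul (h.measurable_reaction.comp
    (by fun_prop : Measurable fun p : ℝ × X => (v p.1, p.2)))

theorem norm_mul_le (h : IsDominatedReaction μ K g M B) {v : ℝ → ℝ} (hvM : ∀ s, v s ∈ Icc 0 M)
    (τ : X) (s : ℝ) : ‖K s τ * g (v s) τ‖ ≤ B τ * K s τ := by
  have hg := h.reaction_mem τ (v s) (hvM s)
  rw [Real.norm_of_nonneg (mul_nonneg (h.kernel_nonneg s τ) hg.1), mul_comm]
  exact mul_le_mul_of_nonneg_right hg.2 (h.kernel_nonneg s τ)

theorem integrable_mul (h : IsDominatedReaction μ K g M B) {v : ℝ → ℝ} (hv : Measurable v)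
    (hvM : ∀ s, v s ∈ Icc 0 M) (τ : X) : Integrable fun s => K s τ * g (v s) τ := by
  refine Integrable.mono' ((h.integrable_kernel τ).const_mul (B τ)) ?_
    (Eventually.of_forall (h.norm_mul_le hvM τ))
  exact ((h.measurable_mul hv).comp
    (by fun_prop : Measurable fun s : ℝ => (s, τ))).aestronglyMeasurable

theorem aestronglyMeasurable_integral (h : IsDominatedReaction μ K g M B) {v : ℝ → ℝ}
    (hv : Measurable v) : AEStronglyMeasurable (fun τ => ∫ s, K s τ * g (v s) τ) μ :=
  (h.measurable_mul hv).stronglyMeasurable.integral_prod_left'.aestronglyMeasurable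

theorem norm_integral_le (h : IsDominatedReaction μ K g M B) {v : ℝ → ℝ}
    (hvM : ∀ s, v s ∈ Icc 0 M) (τ : X) :
    ‖∫ s, K s τ * g (v s) τ‖ ≤ B τ * ∫ s, K s τ := by
  rw [← integral_const_mul]
  exact norm_integral_le_of_norm_le ((h.integrable_kernel τ).const_mul (B τ))
    (Eventually.of_forall (h.norm_mul_le hvM τ))

theorem integrable_integral (h : IsDominatedReaction μ K g M B) {v : ℝ → ℝ} (hv : Measurable v)
    (hvM : ∀ s, v s ∈ Icc 0 M) : Integrable (fun τ => ∫ s, K s τ * g (v s) τ) μ :=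
  Integrable.mono' h.integrable_bound (h.aestronglyMeasurable_integral hv)
    (Eventually.of_forall (h.norm_integral_le hvM))

theorem ofReal_integral_eq (h : IsDominatedReaction μ K g M B) {v : ℝ → ℝ} (hv : Measurable v)
    (hvM : ∀ s, v s ∈ Icc 0 M) :
    ENNReal.ofReal (∫ τ, (∫ s, K s τ * g (v s) τ) ∂μ) =
      ∫⁻ τ, (∫⁻ s, ENNReal.ofReal (K s τ * g (v s) τ)) ∂μ := by
  have hnn : ∀ τ s, 0 ≤ K s τ * g (v s) τ := fun τ s =>
    mul_nonneg (h.kernel_nonneg s τ) (h.reaction_mem τ (v s) (hvM s)).1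
  rw [ofReal_integral_eq_lintegral_ofReal (h.integrable_integral hv hvM)
    (Eventually.of_forall fun τ => integral_nonneg (hnn τ))]
  refine lintegral_congr fun τ => ?_
  rw [ofReal_integral_eq_lintegral_ofReal (h.integrable_mul hv hvM τ)
    (Eventually.of_forall (hnn τ))]

theorem uniformContinuous (h : IsDominatedReaction μ K g M B) {φ : ℝ → ℝ} (hφ : Continuous φ)
    (hφM : ∀ t, φ t ∈ Icc 0 M)
    (hφeq : ∀ t, φ t = ∫ τ, (∫ s, K s τ * g (φ (t - s)) τ) ∂μ) : UniformContinuous φ := by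
  have hKd : ∀ d : ℝ, Measurable fun p : ℝ × X => |K (p.1 + d) p.2 - K p.1 p.2| := fun d =>
    ((h.measurable_kernel.comp (by fun_prop : Measurable fun p : ℝ × X => (p.1 + d, p.2))).sub
      h.measurable_kernel).abs
  have hKdi : ∀ (d : ℝ) (τ : X), Integrable fun s => |K (s + d) τ - K s τ| := fun d τ =>
    (((h.integrable_kernel τ).comp_add_right d).sub (h.integrable_kernel τ)).abs
  have hKdm : ∀ d : ℝ, AEStronglyMeasurable
      (fun τ => B τ * ∫ s, |K (s + d) τ - K s τ|) μ := fun d =>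
    h.measurable_bound.aestronglyMeasurable.mul
      (hKd d).stronglyMeasurable.integral_prod_left'.aestronglyMeasurable
  have hKdle : ∀ (d : ℝ) (τ : X), ‖B τ * ∫ s, |K (s + d) τ - K s τ|‖ ≤
      2 * (B τ * ∫ s, K s τ) := by
    intro d τ
    rw [Real.norm_of_nonneg (mul_nonneg (h.bound_nonneg τ) (integral_nonneg fun _ => abs_nonneg _)),
      mul_left_comm]
    refine mul_le_mul_of_nonneg_left ?_ (h.bound_nonneg τ)
    calc ∫ s, |K (s + d) τ - K s τ| ≤ ∫ s, (K (s + d) τ + K s τ) := by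
          refine integral_mono (hKdi d τ)
            (((h.integrable_kernel τ).comp_add_right d).add (h.integrable_kernel τ)) fun s => ?_
          have h1 := h.kernel_nonneg s τ
          have h2 := h.kernel_nonneg (s + d) τ
          exact abs_le.2 ⟨by linarith, by linarith⟩
      _ = 2 * ∫ s, K s τ := by
          rw [integral_add ((h.integrable_kernel τ).comp_add_right d) (h.integrable_kernel τ),
            integral_add_right_eq_self (fun s => K s τ) d]
          ring
  have hlim : Tendsto (fun d => ∫ τ, B τ * (∫ s, |K (s + d) τ - K s τ|) ∂μ) (𝓝 0)
      (𝓝 (∫ _ : X, (0 : ℝ) ∂μ)) := by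
    refine tendsto_integral_filter_of_dominated_convergence
      (fun τ => 2 * (B τ * ∫ s, K s τ)) (Eventually.of_forall hKdm)
      (Eventually.of_forall fun d => Eventually.of_forall (hKdle d))
      (h.integrable_bound.const_mul 2) (Eventually.of_forall fun τ => ?_)
    simpa using (tendsto_integral_abs_translate_sub (h.integrable_kernel τ)).const_mul (B τ)
  have hle : ∀ t d, |φ (t + d) - φ t| ≤ ∫ τ, B τ * (∫ s, |K (s + d) τ - K s τ|) ∂μ := by
    intro t d
    have hm : ∀ t, Measurable fun s => φ (t - s) := fun t => hφ.measurable.comp (by fun_prop)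
    have h1 : φ (t + d) = ∫ τ, (∫ s, K (s + d) τ * g (φ (t - s)) τ) ∂μ := by
      rw [hφeq]
      refine integral_congr_ae (Eventually.of_forall fun τ => ?_)
      dsimp only
      rw [← integral_add_right_eq_self (fun s => K s τ * g (φ (t + d - s)) τ) d]
      simp
    have hi1 : ∀ τ, Integrable fun s => K (s + d) τ * g (φ (t - s)) τ := fun τ => by
      simpa using (h.integrable_mul (hm (t + d)) (fun s => hφM _) τ).comp_add_right d
    have hi2 : Integrable (fun τ => ∫ s, K (s + d) τ * g (φ (t - s)) τ) μ := by
      refine (h.integrable_integral (hm (t + d)) (fun s => hφM _)).congr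
        (Eventually.of_forall fun τ => ?_)
      dsimp only
      rw [← integral_add_right_eq_self (fun s => K s τ * g (φ (t + d - s)) τ) d]
      simp
    rw [h1, hφeq t, ← integral_sub hi2 (h.integrable_integral (hm t) (fun s => hφM _)),
      ← Real.norm_eq_abs]
    refine norm_integral_le_of_norm_le
      (Integrable.mono' (h.integrable_bound.const_mul 2) (hKdm d)
        (Eventually.of_forall (hKdle d))) (Eventually.of_forall fun τ => ?_)
    rw [← integral_sub (hi1 τ) (h.integrable_mul (hm t) (fun s => hφM _) τ), ← integral_const_mul]
    refine norm_integral_le_of_norm_le ((hKdi d τ).const_mul _) (Eventually.of_forall fun s => ?_)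
    have hg := h.reaction_mem τ _ (hφM (t - s))
    rw [← sub_mul, norm_mul, Real.norm_eq_abs, Real.norm_of_nonneg hg.1, mul_comm]
    gcongr
    exact hg.2
  rw [integral_zero, Metric.tendsto_nhds] at hlim
  refine Metric.uniformContinuous_iff.2 fun e he => ?_
  obtain ⟨d, hd, hde⟩ := Metric.eventually_nhds_iff.1 (hlim e he)
  refine ⟨d, hd, fun {x y} hxy => ?_⟩
  have h1 := hle y (x - y)
  rw [add_sub_cancel] at h1
  have h2 := hde (y := x - y) (by rwa [dist_zero_right, ← dist_eq_norm])
  rw [Real.dist_eq, sub_zero] at h2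
  rw [Real.dist_eq]
  exact h1.trans_lt ((le_abs_self _).trans_lt h2)

theorem eq_integral_of_tendsto (h : IsDominatedReaction μ K g M B)
    (hgcont : ∀ τ, ContinuousOn (fun u => g u τ) (Ici 0)) {w : ℕ → ℝ → ℝ} {ψ : ℝ → ℝ}
    (hw : ∀ j, Measurable (w j)) (hwM : ∀ j t, w j t ∈ Icc 0 M)
    (hweq : ∀ j t, w j t = ∫ τ, (∫ s, K s τ * g (w j (t - s)) τ) ∂μ)
    (hlim : ∀ t, Tendsto (fun j => w j t) atTop (𝓝 (ψ t))) (t : ℝ) :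
    ψ t = ∫ τ, (∫ s, K s τ * g (ψ (t - s)) τ) ∂μ := by
  have hψM : ∀ t, ψ t ∈ Icc 0 M := fun t =>
    isClosed_Icc.mem_of_tendsto (hlim t) (Eventually.of_forall fun j => hwM j t)
  have hm : ∀ j, Measurable fun s => w j (t - s) := fun j => (hw j).comp (by fun_prop)
  refine tendsto_nhds_unique (hlim t) ?_
  simp_rw [fun j => hweq j t]
  refine tendsto_integral_of_dominated_convergence (fun τ => B τ * ∫ s, K s τ)
    (fun j => h.aestronglyMeasurable_integral (hm j)) h.integrable_bound
    (fun j => Eventually.of_forall (h.norm_integral_le fun s => hwM j _))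
    (Eventually.of_forall fun τ => ?_)
  refine tendsto_integral_of_dominated_convergence (fun s => B τ * K s τ)
    (fun j => (h.integrable_mul (hm j) (fun s => hwM j _) τ).aestronglyMeasurable)
    ((h.integrable_kernel τ).const_mul _)
    (fun j => Eventually.of_forall (h.norm_mul_le (fun s => hwM j _) τ))
    (Eventually.of_forall fun s => ?_)
  refine Tendsto.const_mul _ ?_
  refine (hgcont τ (ψ (t - s)) (hψM _).1).tendsto.comp ?_
  exact tendsto_nhdsWithin_iff.2 ⟨hlim _, Eventually.of_forall fun j => (hwM j _).1⟩

end IsDominatedReaction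

theorem IsDominatedReaction.exists_pos_solution_le {X : Type*} [MeasurableSpace X] {μ : Measure X}
    {K g : ℝ → X → ℝ} {M : ℝ} {B : X → ℝ} (h : IsDominatedReaction μ K g M B)
    (hgcont : ∀ τ, ContinuousOn (fun u => g u τ) (Ici 0))
    (hP : ∀ ψ : ℝ → ℝ, Continuous ψ → (∀ t, 0 ≤ ψ t) → (∃ M, ∀ t, ψ t ≤ M) →
      (∀ t, ψ t = ∫ τ, (∫ s, K s τ * g (ψ (t - s)) τ) ∂μ) →
      (∃ t0, ψ t0 = 0) → ∀ t, ψ t = 0)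
    {φ : ℝ → ℝ} (hφ : Continuous φ) (hφpos : ∀ t, 0 < φ t) (hφM : ∀ t, φ t ≤ M)
    (hφeq : ∀ t, φ t = ∫ τ, (∫ s, K s τ * g (φ (t - s)) τ) ∂μ)
    (hlow : ∀ e > 0, ∃ᶠ t in atBot, φ t < e) {e : ℝ} (he : 0 < e) :
    ∃ ψ : ℝ → ℝ, Continuous ψ ∧ (∀ t, 0 < ψ t) ∧ (∀ t, ψ t ≤ M) ∧
      (∀ t, ψ t = ∫ τ, (∫ s, K s τ * g (ψ (t - s)) τ) ∂μ) ∧ ∀ t < 0, ψ t ≤ e := by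
  have hshift : ∀ b t, φ (t + b) = ∫ τ, (∫ s, K s τ * g (φ (t - s + b)) τ) ∂μ := by
    intro b t
    rw [hφeq]
    simp_rw [add_sub_right_comm]
  have hφI : ∀ t, φ t ∈ Icc 0 M := fun t => ⟨(hφpos t).le, hφM t⟩
  have hφu : UniformContinuous φ := h.uniformContinuous hφ hφI hφeq
  by_cases hT : ∃ T, ∀ t ≤ T, φ t ≤ e
  · obtain ⟨T, hT⟩ := hT
    exact ⟨fun t => φ (t + T), by fun_prop, fun t => hφpos _, fun t => hφM _, hshift T,
      fun t ht => hT _ (by linarith)⟩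
  obtain ⟨p, -, hp⟩ : ∃ t ≤ (0 : ℝ), e < φ t := by
    push Not at hT
    exact hT 0
  have ha : ∀ n : ℕ, ∃ a ≤ p, φ a < 1 / ((n : ℝ) + 1) := fun n => by
    obtain ⟨a, ha, hap⟩ := ((hlow (1 / ((n : ℝ) + 1)) (by positivity)).and_eventually
      (eventually_le_atBot p)).exists
    exact ⟨a, hap, ha⟩
  choose a hap ha1 using ha
  have hb : ∀ n, ∃ b, a n ≤ b ∧ e ≤ φ b ∧ ∀ t, a n ≤ t → t < b → φ t < e := fun n => by
    have hc : IsCompact (Icc (a n) p ∩ {t | e ≤ φ t}) :=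
      isCompact_Icc.inter_right (isClosed_le continuous_const hφ)
    obtain ⟨b, ⟨hbI, hbe⟩, hbmin⟩ := hc.exists_isLeast ⟨p, ⟨hap n, le_rfl⟩, hp.le⟩
    refine ⟨b, hbI.1, hbe, fun t hat htb => ?_⟩
    by_contra! hle
    exact absurd (hbmin ⟨⟨hat, htb.le.trans hbI.2⟩, hle⟩) (not_le.2 htb)
  choose b hab' hbe hab using hb
  obtain ⟨ψ, n, hn, hψu, hψ⟩ := exists_subseq_translates_tendsto hφu hφI b
  have hψI : ∀ t, ψ t ∈ Icc 0 M := fun t =>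
    isClosed_Icc.mem_of_tendsto (hψ t) (Eventually.of_forall fun j => hφI _)
  have hψeq := h.eq_integral_of_tendsto hgcont (w := fun j t => φ (t + b (n j)))
    (fun j => by have := hφ.measurable; fun_prop) (fun j t => hφI _) (fun j t => hshift _ t) hψ
  have hψ0 : e ≤ ψ 0 := ge_of_tendsto' (hψ 0) fun j => by simpa using hbe (n j)
  have hψpos : ∀ t, 0 < ψ t := fun t => by
    refine lt_of_le_of_ne (hψI t).1 fun h0 => ?_
    have := hP ψ hψu.continuous (fun t => (hψI t).1) ⟨M, fun t => (hψI t).2⟩ hψeq ⟨t, h0.symm⟩ 0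
    linarith
  refine ⟨ψ, hψu.continuous, hψpos, fun t => (hψI t).2, hψeq, fun x hx => ?_⟩
  have hev : ∀ᶠ j in atTop, a (n j) ≤ x + b (n j) := by
    by_contra hfreq
    rw [not_eventually] at hfreq
    have hfreq' : ∃ᶠ j in atTop, a (n j) - b (n j) ∈ Icc x 0 := by
      exact hfreq.mono fun j hj => ⟨by linarith, by linarith [hab' (n j)]⟩
    obtain ⟨c, -, m, hm, hc⟩ := isCompact_Icc.tendsto_subseq' hfreq'
    have h1 := tendsto_translates_of_tendsto hφu ((hψ c).comp hm.tendsto_atTop) hc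
    have h2 : Tendsto (fun j => φ (a (n (m j)))) atTop (𝓝 0) :=
      squeeze_zero (fun j => (hφpos _).le) (fun j => (ha1 _).le)
        (tendsto_one_div_add_atTop_nhds_zero_nat.comp (hn.comp hm).tendsto_atTop)
    have h3 : ψ c = 0 := tendsto_nhds_unique h1 (by simpa using h2)
    exact (hψpos c).ne' h3
  refine le_of_tendsto (hψ x) ?_
  filter_upwards [hev] with j hj
  exact (hab (n j) _ hj (by linarith)).le

/-- The infimum of the difference quotients `g u τ / u` over rational `u ∈ (0, 1 / (n + 1))`. -/
noncomputable def lowerSlope {X : Type*} (g : ℝ → X → ℝ) (n : ℕ) (τ : X) : ENNReal :=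
  ⨅ (p : ℚ) (_ : 0 < p ∧ (p : ℝ) < 1 / ((n : ℝ) + 1)), ENNReal.ofReal (g p τ / p)

section lowerSlope

variable {X : Type*} {g : ℝ → X → ℝ}

theorem measurable_lowerSlope [MeasurableSpace X] (hg : Measurable fun p : ℝ × X => g p.1 p.2)
    (n : ℕ) : Measurable (lowerSlope g n) := by
  refine Measurable.iInf fun p => Measurable.iInf fun _ => ?_
  exact ((hg.comp (by fun_prop : Measurable fun τ : X => ((p : ℝ), τ))).div_const _).ennreal_ofReal

theorem monotone_lowerSlope (g : ℝ → X → ℝ) : Monotone (lowerSlope g) := by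
  intro m n hmn τ
  refine le_iInf₂ fun p hp => iInf₂_le p ⟨hp.1, hp.2.trans_le ?_⟩
  gcongr

theorem lowerSlope_mul_le {τ : X} (hg : ContinuousOn (fun u => g u τ) (Ici 0)) {n : ℕ} {u : ℝ}
    (hu : 0 < u) (hun : u < 1 / ((n : ℝ) + 1)) :
    lowerSlope g n τ * ENNReal.ofReal u ≤ ENNReal.ofReal (g u τ) := by
  obtain ⟨p, -, hp, hplim⟩ := Real.exists_seq_rat_strictMono_tendsto u
  have hgu : ContinuousAt (fun u => g u τ) u := hg.continuousAt (Ici_mem_nhds hu)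
  have hlim : Tendsto (fun j => ENNReal.ofReal (g (p j) τ / p j)) atTop
      (𝓝 (ENNReal.ofReal (g u τ / u))) :=
    ENNReal.tendsto_ofReal ((hgu.tendsto.comp hplim).div hplim hu.ne')
  have hle : lowerSlope g n τ ≤ ENNReal.ofReal (g u τ / u) := by
    refine ge_of_tendsto hlim ?_
    filter_upwards [hplim.eventually_const_lt hu] with j hj
    exact iInf₂_le (p j) ⟨by exact_mod_cast hj, (hp j).trans hun⟩
  calc lowerSlope g n τ * ENNReal.ofReal u
      ≤ ENNReal.ofReal (g u τ / u) * ENNReal.ofReal u := by gcongr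
    _ = ENNReal.ofReal (g u τ) := by
      rw [← ENNReal.ofReal_mul' hu.le, div_mul_cancel₀ _ hu.ne']

theorem le_iSup_lowerSlope {τ : X} {c : ℝ}
    (hlim : Tendsto (fun u => g u τ / u) (𝓝[>] 0) (𝓝 c)) :
    ENNReal.ofReal c ≤ ⨆ n, lowerSlope g n τ := by
  refine le_of_forall_lt fun a ha => ?_
  obtain ⟨b, hab, hb⟩ := exists_between ha
  have hev := (ENNReal.tendsto_ofReal hlim).eventually_const_lt hb
  obtain ⟨d, hd, hdb⟩ := mem_nhdsGT_iff_exists_Ioo_subset.1 hev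
  obtain ⟨n, hn⟩ := exists_nat_one_div_lt (show (0 : ℝ) < d from hd)
  refine hab.trans_le (le_iSup_of_le n (le_iInf₂ fun p hp => ?_))
  have : (p : ℝ) ∈ Ioo 0 d := ⟨by exact_mod_cast hp.1, hp.2.trans hn⟩
  exact (hdb this).le

end lowerSlope

theorem IsDominatedReaction.lintegral_lowerSlope_le {X : Type*} [MeasurableSpace X]
    {μ : Measure X} [SFinite μ] {K g : ℝ → X → ℝ} {M : ℝ} {B : X → ℝ}
    (h : IsDominatedReaction μ K g M B)
    (hgcont : ∀ τ, ContinuousOn (fun u => g u τ) (Ici 0)) {ψ : ℝ → ℝ} (hψ : Measurable ψ)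
    (hψpos : ∀ t, 0 < ψ t) (hψM : ∀ t, ψ t ≤ M)
    (hψeq : ∀ t, ψ t = ∫ τ, (∫ s, K s τ * g (ψ (t - s)) τ) ∂μ) {n : ℕ} {t : ℝ}
    (hsmall : ∀ s : ℝ, |s| ≤ n → ψ (t - s) < 1 / ((n : ℝ) + 1)) :
    ∫⁻ s, (Metric.closedBall (0 : ℝ) n).indicator
        (fun s => ∫⁻ τ, ENNReal.ofReal (K s τ) * lowerSlope g n τ ∂μ) s *
      ENNReal.ofReal (ψ (t - s)) ≤ ENNReal.ofReal (ψ t) := by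
  have hm := measurable_lowerSlope h.measurable_reaction n
  have hK := h.measurable_kernel
  have hv : Measurable fun s => ψ (t - s) := by fun_prop
  have hvI : ∀ s, ψ (t - s) ∈ Icc 0 M := fun s => ⟨(hψpos _).le, hψM _⟩
  have hF := (h.measurable_mul hv).ennreal_ofReal
  rw [hψeq t, h.ofReal_integral_eq hv hvI, lintegral_lintegral_swap
    (f := fun τ s => ENNReal.ofReal (K s τ * g (ψ (t - s)) τ))
    (hF.comp measurable_swap).aemeasurable]
  refine lintegral_mono fun s => ?_
  by_cases hs : s ∈ Metric.closedBall (0 : ℝ) n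
  · rw [indicator_of_mem hs, ← lintegral_mul_const]
    · refine lintegral_mono fun τ => ?_
      dsimp only
      rw [mul_assoc, ENNReal.ofReal_mul (h.kernel_nonneg s τ)]
      gcongr
      refine lowerSlope_mul_le (hgcont τ) (hψpos _) (hsmall s ?_)
      simpa using hs
    · exact (hK.comp (by fun_prop : Measurable fun τ : X => (s, τ))).ennreal_ofReal.mul hm
  · simp [indicator_of_notMem hs]

theorem max_zero_add_sq_le (x s : ℝ) :
    (max (x + s) 0) ^ 2 ≤ (max x 0) ^ 2 + 2 * max x 0 * s + s ^ 2 := by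
  rcases le_total x 0 with hx | hx <;> rcases le_total (x + s) 0 with hs | hs <;>
    simp only [max_eq_left, max_eq_right, hx, hs] <;> nlinarith

/-- A kernel of bounded support whose bilateral Laplace transform exceeds `1` on a long enough
interval has no positive supersolution on a left half-line. -/
theorem false_of_supersolution {k ψ : ℝ → ENNReal} (hk : Measurable k) (hψ : Measurable ψ)
    {R c h Z : ℝ} (hR : 0 < R) (hc : 1 < c) (hh : 0 < h) (hZ : 0 ≤ Z)
    (hsupp : ∀ s, R < |s| → k s = 0)
    (h1 : ∀ z ∈ Icc (-h) (Z + 1),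
      ENNReal.ofReal c ≤ ∫⁻ s, k s * ENNReal.ofReal (Real.exp (-(s * z))))
    (h2 : ∀ z ∈ Icc Z (Z + 1),
      ENNReal.ofReal c ≤ ∫⁻ s in Iic 0, k s * ENNReal.ofReal (Real.exp (-(s * z))))
    (hpos : ∀ t, 0 < ψ t) {M : ENNReal} (hM : M ≠ ⊤) (hψM : ∀ t ≤ 0, ψ t ≤ M)
    (hsup : ∀ t ≤ 0, ∫⁻ s, k s * ψ (t - s) ≤ ψ t) : False := by
  obtain ⟨l, hl, hlR, hlc⟩ : ∃ l : ℝ, 0 < l ∧ l * R ≤ 1 ∧ 1 < c * Real.exp (-(l / 2 * R ^ 2)) := by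
    have hlog := Real.log_pos hc
    refine ⟨min (1 / R) (Real.log c / R ^ 2), by positivity, ?_, ?_⟩
    · calc _ ≤ 1 / R * R := by gcongr; exact min_le_left _ _
        _ = 1 := by field_simp
    · have : min (1 / R) (Real.log c / R ^ 2) * R ^ 2 ≤ Real.log c := by
        calc _ ≤ Real.log c / R ^ 2 * R ^ 2 := by gcongr; exact min_le_right _ _
          _ = _ := by field_simp
      nth_rewrite 1 [← Real.exp_log (by linarith : 0 < c)]
      rw [← Real.exp_add, Real.one_lt_exp_iff]
      linarith
  set T : ℝ := (Z + 1 + h) / l with hT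
  have hlT : l * T = Z + 1 + h := by rw [hT]; field_simp
  have hTpos : 0 < T := by positivity
  let f : ℝ → ℝ := fun t => h * (t + T) - l / 2 * (max (t + T) 0) ^ 2
  let W : ℝ → ENNReal := (Iic (0 : ℝ)).indicator fun t => ENNReal.ofReal (Real.exp (f t))
  have hWm : Measurable W := by
    refine Measurable.indicator ?_ measurableSet_Iic
    fun_prop
  have hWsucc : ∀ r ≤ 0, ENNReal.ofReal (c * Real.exp (-(l / 2 * R ^ 2))) * W r ≤
      ∫⁻ s, k s * W (r + s) := by
    intro r hr
    set z : ℝ := l * max (r + T) 0 - h with hz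
    have hz1 : z ∈ Icc (-h) (Z + 1) := by
      have : max (r + T) 0 ≤ T := max_le (by linarith) hTpos.le
      have h0 : 0 ≤ max (r + T) 0 := le_max_right _ _
      constructor
      · have := mul_nonneg hl.le h0
        linarith
      · nlinarith
    obtain ⟨S, hSm, hSc, hS⟩ : ∃ S : Set ℝ, MeasurableSet S ∧
        ENNReal.ofReal c ≤ ∫⁻ s in S, k s * ENNReal.ofReal (Real.exp (-(s * z))) ∧
        ∀ s ∈ S, |s| ≤ R → r + s ≤ 0 := by
      rcases le_or_gt r (-R) with hrR | hrR
      · refine ⟨univ, MeasurableSet.univ, by simpa using h1 z hz1, fun s _ hs => ?_⟩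
        linarith [le_abs_self s]
      · refine ⟨Iic 0, measurableSet_Iic, h2 z ⟨?_, hz1.2⟩, fun s hs _ => ?_⟩
        · have := le_max_left (r + T) 0
          nlinarith
        · have : s ≤ 0 := hs
          linarith
    have hWr : W r = ENNReal.ofReal (Real.exp (f r)) := indicator_of_mem (mem_Iic.2 hr) _
    calc ENNReal.ofReal (c * Real.exp (-(l / 2 * R ^ 2))) * W r
        = ENNReal.ofReal c * ENNReal.ofReal (Real.exp (-(l / 2 * R ^ 2)) * Real.exp (f r)) := by
          rw [hWr, ENNReal.ofReal_mul (by linarith), ENNReal.ofReal_mul (Real.exp_nonneg _),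
            mul_assoc]
      _ ≤ (∫⁻ s in S, k s * ENNReal.ofReal (Real.exp (-(s * z)))) *
            ENNReal.ofReal (Real.exp (-(l / 2 * R ^ 2)) * Real.exp (f r)) := by gcongr
      _ = ∫⁻ s in S, k s * ENNReal.ofReal (Real.exp (-(s * z))) *
            ENNReal.ofReal (Real.exp (-(l / 2 * R ^ 2)) * Real.exp (f r)) := by
          rw [lintegral_mul_const]
          fun_prop
      _ ≤ ∫⁻ s in S, k s * W (r + s) := by
          refine setLIntegral_mono (by fun_prop) fun s hs => ?_
          rcases lt_or_ge R |s| with hsR | hsR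
          · simp [hsupp s hsR]
          · have : W (r + s) = ENNReal.ofReal (Real.exp (f (r + s))) :=
              indicator_of_mem (mem_Iic.2 (hS s hs hsR)) _
            rw [this, mul_assoc, ← ENNReal.ofReal_mul (Real.exp_nonneg _), ← Real.exp_add,
              ← Real.exp_add]
            gcongr
            have h3 := max_zero_add_sq_le (r + T) s
            have h4 : s ^ 2 ≤ R ^ 2 := sq_le_sq' (abs_le.1 hsR).1 (abs_le.1 hsR).2
            have h5 : r + s + T = r + T + s := by ring
            simp only [f, h5, hz]
            nlinarith
      _ ≤ ∫⁻ s, k s * W (r + s) := setLIntegral_le_lintegral _ _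
  have hfin : ∫⁻ t, W t * ψ t ≠ ⊤ := by
    have hint : ∫⁻ t in Iic (0 : ℝ), ENNReal.ofReal (Real.exp (h * t)) ≠ ⊤ := by
      have := (integrableOn_exp_mul_Iic hh 0).lintegral_lt_top
      exact this.ne
    refine ne_top_of_le_ne_top (b := ∫⁻ t in Iic (0 : ℝ),
      ENNReal.ofReal (Real.exp (h * t)) * (ENNReal.ofReal (Real.exp (h * T)) * M)) ?_ ?_
    · rw [lintegral_mul_const _ (by fun_prop)]
      finiteness
    · rw [← lintegral_indicator measurableSet_Iic]
      refine lintegral_mono fun t => ?_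
      by_cases ht : t ∈ Iic (0 : ℝ)
      · simp only [W, indicator_of_mem ht]
        rw [← mul_assoc, ← ENNReal.ofReal_mul (Real.exp_nonneg _), ← Real.exp_add]
        gcongr
        · simp only [f]
          have : 0 ≤ l / 2 * max (t + T) 0 ^ 2 := by positivity
          linarith
        · exact hψM t ht
      · simp [W, indicator_of_notMem ht]
  have hne : ∫⁻ t, W t * ψ t ≠ 0 := by
    rw [Ne, lintegral_eq_zero_iff (by fun_prop)]
    intro h0
    have hsub : volume (Iic (0 : ℝ)) ≤ 0 := by
      rw [← ae_iff.1 h0]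
      refine measure_mono fun t ht => ?_
      simp only [mem_ofPred_eq, Pi.zero_apply, mul_eq_zero, (hpos t).ne', or_false]
      simp only [W, indicator_of_mem ht]
      simpa using Real.exp_pos _
    simp at hsub
  have hmain : ENNReal.ofReal (c * Real.exp (-(l / 2 * R ^ 2))) * ∫⁻ t, W t * ψ t ≤
      ∫⁻ t, W t * ψ t := by
    calc ENNReal.ofReal (c * Real.exp (-(l / 2 * R ^ 2))) * ∫⁻ t, W t * ψ t
        = ∫⁻ r, (ENNReal.ofReal (c * Real.exp (-(l / 2 * R ^ 2))) * W r) * ψ r := by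
          rw [← lintegral_const_mul _ (by fun_prop)]
          simp only [mul_assoc]
      _ ≤ ∫⁻ r, (∫⁻ s, k s * W (r + s)) * ψ r := by
          refine lintegral_mono fun r => ?_
          dsimp only
          gcongr
          rcases le_or_gt r 0 with hr | hr
          · exact hWsucc r hr
          · simp [W, hr]
      _ = ∫⁻ r, ∫⁻ s, k s * W (r + s) * ψ r := by
          refine lintegral_congr fun r => ?_
          rw [lintegral_mul_const _ (by fun_prop)]
      _ = ∫⁻ s, ∫⁻ r, k s * W (r + s) * ψ r := by
          rw [lintegral_lintegral_swap]
          exact Measurable.aemeasurable (by fun_prop)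
      _ = ∫⁻ s, ∫⁻ t, k s * W t * ψ (t - s) := by
          refine lintegral_congr fun s => ?_
          rw [← lintegral_add_right_eq_self (fun t => k s * W t * ψ (t - s)) s]
          simp
      _ = ∫⁻ t, ∫⁻ s, k s * W t * ψ (t - s) := by
          rw [lintegral_lintegral_swap]
          exact Measurable.aemeasurable (by fun_prop)
      _ = ∫⁻ t, W t * ∫⁻ s, k s * ψ (t - s) := by
          refine lintegral_congr fun t => ?_
          rw [← lintegral_const_mul _ (by fun_prop)]
          refine lintegral_congr fun s => ?_
          ring
      _ ≤ ∫⁻ t, W t * ψ t := by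
          refine lintegral_mono fun t => ?_
          rcases le_or_gt t 0 with ht | ht
          · dsimp only
            gcongr
            exact hsup t ht
          · simp [W, ht]
  have : ENNReal.ofReal (c * Real.exp (-(l / 2 * R ^ 2))) ≤ 1 := by
    rw [← ENNReal.mul_le_mul_iff_left hne hfin]
    simpa using hmain
  rw [ENNReal.ofReal_le_one] at this
  linarith

theorem one_lt_lintegral_mul_exp {k : ℝ → ENNReal} (hk : Measurable k) (hfin : ∫⁻ s, k s ≠ ⊤)
    (hk1 : 1 < ∫⁻ s, k s)
    (hne : ∀ z : ℝ, 0 < z → ∫⁻ s, k s * ENNReal.ofReal (Real.exp (-(s * z))) ≠ 1)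
    {z : ℝ} (hz : 0 ≤ z) : 1 < ∫⁻ s, k s * ENNReal.ofReal (Real.exp (-(s * z))) := by
  by_contra! hle
  have h0 : ∫⁻ s, k s * ENNReal.ofReal (Real.exp (-(s * 0))) = ∫⁻ s, k s := by simp
  have hcont : ContinuousOn (fun y => ∫⁻ s, k s * ENNReal.ofReal (Real.exp (-(s * y))))
      (Icc 0 z) := by
    intro y _
    refine tendsto_lintegral_filter_of_dominated_convergence
      (fun s => k s + k s * ENNReal.ofReal (Real.exp (-(s * z))))
      (Eventually.of_forall fun y => by fun_prop) ?_ ?_ ?_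
    · filter_upwards [self_mem_nhdsWithin] with y hy
      refine Eventually.of_forall fun s => ?_
      rcases le_total 0 s with hs | hs
      · refine le_add_right ?_
        calc _ ≤ k s * ENNReal.ofReal 1 := by
              gcongr
              rw [Real.exp_le_one_iff]
              nlinarith [hy.1]
          _ = k s := by simp
      · refine le_add_left ?_
        gcongr k s * ENNReal.ofReal (Real.exp ?_)
        nlinarith [hy.2]
    · rw [lintegral_add_left hk]
      exact ENNReal.add_ne_top.2 ⟨hfin, (hle.trans_lt ENNReal.one_lt_top).ne⟩
    · refine Eventually.of_forall fun s => ?_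
      refine ENNReal.Tendsto.const_mul ?_ (Or.inl ?_)
      · exact ((ENNReal.continuous_ofReal.comp (by fun_prop)).tendsto y).mono_left
          nhdsWithin_le_nhds
      · simpa using Real.exp_pos _
  obtain ⟨y, hy, hy1⟩ := intermediate_value_Icc' hz hcont ⟨hle, by rw [h0]; exact hk1.le⟩
  rcases hy.1.eq_or_lt with rfl | hpos
  · simp only [h0] at hy1
    exact hk1.ne' hy1
  · exact hne y hpos hy1

theorem exists_lt_setLIntegral_mul_exp {k : ℝ → ENNReal} (hk : Measurable k)
    (hfin : ∫⁻ s, k s ≠ ⊤)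
    (hlt : ∀ z : ℝ, 0 ≤ z → 1 < ∫⁻ s, k s * ENNReal.ofReal (Real.exp (-(s * z)))) :
    ∃ Z : ℝ, 0 ≤ Z ∧ 2 < ∫⁻ s in Iic 0, k s * ENNReal.ofReal (Real.exp (-(s * Z))) := by
  by_contra! hle
  have hzero : ∫⁻ s in Iic 0, k s * ENNReal.ofReal (-s) = 0 := by
    by_contra hA
    obtain ⟨n, hn⟩ := ENNReal.exists_nat_mul_gt hA (b := 2) (by simp)
    refine absurd (hle n n.cast_nonneg) (not_le.2 (hn.trans_le ?_))
    rw [← lintegral_const_mul _ (by fun_prop)]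
    refine setLIntegral_mono (by fun_prop) fun s hs => ?_
    have hs : s ≤ 0 := hs
    rw [mul_left_comm, ← ENNReal.ofReal_natCast, ← ENNReal.ofReal_mul n.cast_nonneg]
    gcongr
    have := Real.add_one_le_exp (-(s * n))
    linarith
  have hae : ∀ᵐ s, s < 0 → k s = 0 := by
    rw [lintegral_eq_zero_iff (by fun_prop), EventuallyEq, ae_restrict_iff' measurableSet_Iic]
      at hzero
    filter_upwards [hzero] with s hs hneg
    have := hs hneg.le
    simp only [Pi.zero_apply, mul_eq_zero, ENNReal.ofReal_eq_zero] at this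
    exact this.resolve_right (by linarith)
  have hlim : Tendsto (fun n : ℕ => ∫⁻ s, k s * ENNReal.ofReal (Real.exp (-(s * n)))) atTop
      (𝓝 (∫⁻ _ : ℝ, 0)) := by
    refine tendsto_lintegral_filter_of_dominated_convergence k
      (Eventually.of_forall fun y => by fun_prop) (Eventually.of_forall fun n => ?_) hfin ?_
    · filter_upwards [hae] with s hs
      rcases lt_or_ge s 0 with h | h
      · simp [hs h]
      · calc _ ≤ k s * ENNReal.ofReal 1 := by
              gcongr
              rw [Real.exp_le_one_iff]
              have := mul_nonneg h (n.cast_nonneg (α := ℝ))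
              linarith
          _ = k s := by simp
    · have hkfin := ae_lt_top hk hfin
      filter_upwards [hae, hkfin, Measure.ae_ne volume (0 : ℝ)] with s hs hsf hs0
      rcases lt_or_ge s 0 with h | h
      · simp [hs h]
      · have h' : 0 < s := lt_of_le_of_ne h (Ne.symm hs0)
        have : Tendsto (fun n : ℕ => ENNReal.ofReal (Real.exp (-(s * n)))) atTop (𝓝 0) := by
          rw [← ENNReal.ofReal_zero]
          refine ENNReal.tendsto_ofReal (Real.tendsto_exp_neg_atTop_nhds_zero.comp ?_)
          exact (tendsto_natCast_atTop_atTop).const_mul_atTop h'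
        simpa using ENNReal.Tendsto.const_mul this (Or.inr hsf.ne)
  have := ge_of_tendsto' hlim fun n => (hlt n n.cast_nonneg).le
  simp at this

theorem isOpen_setOf_lt_lintegral_mul_exp {k : ℝ → ENNReal} (hk : Measurable k) (a : ENNReal) :
    IsOpen {z : ℝ | a < ∫⁻ s, k s * ENNReal.ofReal (Real.exp (-(s * z)))} := by
  refine isOpen_iff_mem_nhds.2 fun z hz => ?_
  refine eventually_lt_of_lt_liminf (lt_of_lt_of_le (show a < _ from hz) ?_)
  refine le_trans (lintegral_mono fun s => ?_) (lintegral_liminf_le fun z => by fun_prop)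
  refine (Tendsto.liminf_eq ?_).ge
  refine ENNReal.Tendsto.const_mul ?_ (Or.inl ?_)
  · exact (ENNReal.continuous_ofReal.comp (by fun_prop)).tendsto z
  · simpa using Real.exp_pos _

/-- If the bilateral Laplace transform of `k` starts above `1` and never equals `1` on the positive
half-line, then the members of an exhaustion of `k` by kernels of bounded support eventually
have no positive supersolution on a left half-line. -/
theorem exists_forall_supersolution_false {k : ℝ → ENNReal} (hk : Measurable k)
    (hfin : ∫⁻ s, k s ≠ ⊤) (hk1 : 1 < ∫⁻ s, k s)
    (hne : ∀ z : ℝ, 0 < z → ∫⁻ s, k s * ENNReal.ofReal (Real.exp (-(s * z))) ≠ 1)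
    {q : ℕ → ℝ → ENNReal} (hq : ∀ n, Measurable (q n)) (hmono : Monotone q)
    (hsupp : ∀ (n : ℕ) (s : ℝ), (n : ℝ) < |s| → q n s = 0) (hkq : ∀ s, k s ≤ ⨆ n, q n s) :
    ∃ n, ∀ ψ : ℝ → ENNReal, Measurable ψ → (∀ t, 0 < ψ t) →
      (∃ M : ENNReal, M ≠ ⊤ ∧ ∀ t ≤ 0, ψ t ≤ M) →
      (∀ t ≤ 0, ∫⁻ s, q n s * ψ (t - s) ≤ ψ t) → False := by
  have hlt : ∀ z : ℝ, 0 ≤ z → 1 < ∫⁻ s, k s * ENNReal.ofReal (Real.exp (-(s * z))) :=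
    fun z hz => one_lt_lintegral_mul_exp hk hfin hk1 hne hz
  obtain ⟨Z, hZ, hZ2⟩ := exists_lt_setLIntegral_mul_exp hk hfin hlt
  have hsup : ∀ (S : Set ℝ) (z : ℝ), ∫⁻ s in S, k s * ENNReal.ofReal (Real.exp (-(s * z))) ≤
      ⨆ n, ∫⁻ s in S, q n s * ENNReal.ofReal (Real.exp (-(s * z))) := by
    intro S z
    rw [← lintegral_iSup (fun n => by fun_prop)
      (fun m n hmn s => by dsimp only; gcongr; exact hmono hmn s)]
    refine lintegral_mono fun s => ?_
    dsimp only
    rw [← ENNReal.iSup_mul]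
    gcongr
    exact hkq s
  obtain ⟨n₁, hn₁⟩ := lt_iSup_iff.1 (hZ2.trans_le (hsup (Iic 0) Z))
  let U : ℕ → Set ℝ := fun n =>
    {z : ℝ | ENNReal.ofReal (1 + 1 / (n + 1)) < ∫⁻ s, q n s * ENNReal.ofReal (Real.exp (-(s * z)))}
  have hUmono : Monotone U := by
    intro m n hmn z hz
    calc ENNReal.ofReal (1 + 1 / (n + 1)) ≤ ENNReal.ofReal (1 + 1 / (m + 1)) := by gcongr
      _ < ∫⁻ s, q m s * ENNReal.ofReal (Real.exp (-(s * z))) := hz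
      _ ≤ ∫⁻ s, q n s * ENNReal.ofReal (Real.exp (-(s * z))) := by
        refine lintegral_mono fun s => ?_
        dsimp only
        gcongr
        exact hmono hmn s
  have hUo : ∀ n, IsOpen (U n) := fun n => isOpen_setOf_lt_lintegral_mul_exp (hq n) _
  obtain ⟨n₂, hn₂⟩ : ∃ n, Icc 0 (Z + 1) ⊆ U n := by
    refine isCompact_Icc.elim_directed_cover U hUo (fun z hz => ?_) hUmono.directed_le
    have h1 := (hlt z hz.1).trans_le (by simpa using hsup univ z)
    obtain ⟨m, hm⟩ := lt_iSup_iff.1 h1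
    have hlim : Tendsto (fun n : ℕ => ENNReal.ofReal (1 + 1 / ((n : ℝ) + 1))) atTop (𝓝 1) := by
      rw [← ENNReal.ofReal_one]
      refine ENNReal.tendsto_ofReal ?_
      simpa using tendsto_one_div_add_atTop_nhds_zero_nat.const_add (1 : ℝ)
    obtain ⟨n, hn, hmn⟩ := ((hlim.eventually_lt_const hm).and (eventually_ge_atTop m)).exists
    refine mem_iUnion.2 ⟨n, hn.trans_le ?_⟩
    refine lintegral_mono fun s => ?_
    dsimp only
    gcongr
    exact hmono hmn s
  set n := max n₁ n₂ with hn
  have hUn : Icc 0 (Z + 1) ⊆ U n := hn₂.trans (hUmono (le_max_right _ _))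
  obtain ⟨h, hh, hUh⟩ : ∃ h > 0, Icc (-h) (Z + 1) ⊆ U n := by
    obtain ⟨d, hd, hdU⟩ := Metric.isOpen_iff.1 (hUo n) 0 (hUn ⟨le_rfl, by linarith⟩)
    refine ⟨d / 2, by positivity, fun z hz => ?_⟩
    rcases le_or_gt 0 z with h0 | h0
    · exact hUn ⟨h0, hz.2⟩
    · refine hdU ?_
      rw [Metric.mem_ball, Real.dist_eq, sub_zero, abs_of_neg h0]
      linarith [hz.1]
  refine ⟨n, fun ψ hψ hpos ⟨M, hM, hψM⟩ hψs => ?_⟩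
  refine false_of_supersolution (hq n) hψ (R := n + 1) (c := 1 + 1 / ((n : ℝ) + 1)) (h := h)
    (Z := Z) (by positivity) (by simp; positivity) hh hZ (fun s hs => hsupp n s (by linarith))
    (fun z hz => (hUh hz).le) (fun z hz => ?_) hpos hM hψM hψs
  calc ENNReal.ofReal (1 + 1 / ((n : ℝ) + 1)) ≤ ENNReal.ofReal 2 := by
        gcongr
        have : 1 / ((n : ℝ) + 1) ≤ 1 := by
          rw [div_le_one (by positivity)]
          simp
        linarith
    _ = 2 := by simp
    _ ≤ ∫⁻ s in Iic 0, q n₁ s * ENNReal.ofReal (Real.exp (-(s * Z))) := hn₁.le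
    _ ≤ ∫⁻ s in Iic 0, q n s * ENNReal.ofReal (Real.exp (-(s * z))) := by
        have := hq n
        refine setLIntegral_mono (by fun_prop) fun s hs => ?_
        have hs : s ≤ 0 := hs
        gcongr ?_ * ENNReal.ofReal (Real.exp ?_)
        · exact hmono (le_max_left _ _) s
        · nlinarith [hz.1]

theorem lintegral_lintegral_mul_exp {X : Type*} [MeasurableSpace X] {μ : Measure X} [SFinite μ]
    {F : ℝ → X → ℝ} (hF : Measurable fun p : ℝ × X => F p.1 p.2) (hFnn : ∀ s τ, 0 ≤ F s τ)
    (z : ℝ) :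
    ∫⁻ s, (∫⁻ τ, ENNReal.ofReal (F s τ) ∂μ) * ENNReal.ofReal (Real.exp (-(s * z))) =
      ∫⁻ p : ℝ × X, ENNReal.ofReal (F p.1 p.2 * Real.exp (-(p.1 * z))) ∂(volume.prod μ) := by
  rw [lintegral_prod _ (Measurable.aemeasurable (by fun_prop))]
  refine lintegral_congr fun s => ?_
  have hm : Measurable fun τ => ENNReal.ofReal (F s τ) :=
    (hF.comp (by fun_prop : Measurable fun τ : X => (s, τ))).ennreal_ofReal
  rw [← lintegral_mul_const _ hm]
  simp only [ENNReal.ofReal_mul (hFnn s _)]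

theorem ofReal_integral_integral_eq_lintegral_prod {X : Type*} [MeasurableSpace X] {μ : Measure X}
    [SFinite μ] {F : ℝ → X → ℝ}
    (hFi : Integrable (fun p : ℝ × X => F p.1 p.2) (volume.prod μ)) (hFnn : ∀ s τ, 0 ≤ F s τ) :
    ENNReal.ofReal (∫ τ, (∫ s, F s τ) ∂μ) =
      ∫⁻ p : ℝ × X, ENNReal.ofReal (F p.1 p.2) ∂(volume.prod μ) := by
  rw [← integral_prod_symm _ hFi,
    ofReal_integral_eq_lintegral_ofReal hFi (Eventually.of_forall fun p => hFnn p.1 p.2)]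

theorem liminf_atBot_pos_of_integral_exp_ne_one
    {X : Type*} [MeasurableSpace X] (μ : Measure X) [SFinite μ]
    (K : ℝ → X → ℝ) (g : ℝ → X → ℝ)
    (hKmeas : Measurable fun p : ℝ × X => K p.1 p.2)
    (hKnn : ∀ s τ, 0 ≤ K s τ)
    (hKpos : ∀ τ, 0 < ∫ s, K s τ)
    (hgmeas : Measurable fun p : ℝ × X => g p.1 p.2)
    (hgnn : ∀ u τ, 0 ≤ u → 0 ≤ g u τ)
    (hgcont : ∀ τ, ContinuousOn (fun u => g u τ) (Ici 0))
    (g' : X → ℝ) (hg'meas : Measurable g') (hg'pos : ∀ τ, 0 < g' τ)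
    (hg'lim : ∀ τ, Tendsto (fun u => g u τ / u) (𝓝[>] 0) (𝓝 (g' τ)))
    (hC : ∀ δ : ℝ, 0 < δ → ∃ Cd : X → ℝ, Measurable Cd ∧ (∀ τ, 0 ≤ Cd τ) ∧
      (∀ τ, ∀ u ∈ Icc (0:ℝ) δ, g u τ ≤ Cd τ * u) ∧
      Integrable (fun τ => Cd τ * ∫ s, K s τ) μ)
    (hP : ∀ ψ : ℝ → ℝ, Continuous ψ → (∀ t, 0 ≤ ψ t) → (∃ M, ∀ t, ψ t ≤ M) →
      (∀ t, ψ t = ∫ τ, (∫ s, K s τ * g (ψ (t - s)) τ) ∂μ) →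
      (∃ t0, ψ t0 = 0) → ∀ t, ψ t = 0)
    (hχ0int : Integrable (fun p : ℝ × X => K p.1 p.2 * g' p.2) ((volume : Measure ℝ).prod μ))
    (hχ0 : 1 < ∫ τ, (∫ s, K s τ * g' τ) ∂μ)
    (φ : ℝ → ℝ) (hφc : Continuous φ)
    (hφpos : ∀ t, 0 < φ t)
    (hφbd : ∃ M, ∀ t, φ t ≤ M)
    (hφeq : ∀ t, φ t = ∫ τ, (∫ s, K s τ * g (φ (t - s)) τ) ∂μ)
    (hχ : ∀ z : ℝ, 0 < z →
      Integrable (fun p : ℝ × X => K p.1 p.2 * g' p.2 * Real.exp (-(p.1 * z)))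
        ((volume : Measure ℝ).prod μ) →
      (∫ τ, (∫ s, K s τ * g' τ * Real.exp (-(s * z))) ∂μ) ≠ 1) :
    0 < liminf φ atBot := by
  obtain ⟨M, hM⟩ := hφbd
  have hMpos : 0 < M := (hφpos 0).trans_le (hM 0)
  obtain ⟨C, hCm, hCnn, hCle, hCi⟩ := hC M hMpos
  have h : IsDominatedReaction μ K g M fun τ => C τ * M :=
    { measurable_kernel := hKmeas
      kernel_nonneg := hKnn
      integral_kernel_pos := hKpos
      measurable_reaction := hgmeas
      reaction_mem := fun τ u hu => ⟨hgnn u τ hu.1,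
        (hCle τ u hu).trans (mul_le_mul_of_nonneg_left hu.2 (hCnn τ))⟩
      bound_nonneg := fun τ => mul_nonneg (hCnn τ) hMpos.le
      measurable_bound := hCm.mul_const M
      integrable_bound := by
        refine (hCi.const_mul M).congr (Eventually.of_forall fun τ => ?_)
        dsimp only
        ring }
  by_contra hle
  rw [not_lt] at hle
  have hlow : ∀ e > 0, ∃ᶠ t in atBot, φ t < e := fun e he =>
    frequently_lt_of_liminf_lt
      (isCoboundedUnder_ge_of_le atBot hM) (hle.trans_lt he)
  have hFm : Measurable fun p : ℝ × X => K p.1 p.2 * g' p.2 := by fun_prop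
  have hFnn : ∀ s τ, 0 ≤ K s τ * g' τ := fun s τ => mul_nonneg (hKnn s τ) (hg'pos τ).le
  let k : ℝ → ENNReal := fun s => ∫⁻ τ, ENNReal.ofReal (K s τ * g' τ) ∂μ
  let r : ℕ → ℝ → ENNReal := fun n s => ∫⁻ τ, ENNReal.ofReal (K s τ) * lowerSlope g n τ ∂μ
  let q : ℕ → ℝ → ENNReal := fun n => (Metric.closedBall (0 : ℝ) n).indicator (r n)
  have hslope := fun n => measurable_lowerSlope hgmeas n
  have hk : Measurable k := hFm.ennreal_ofReal.lintegral_prod_right'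
  have hr : ∀ n, Measurable (r n) := fun n =>
    Measurable.lintegral_prod_right' (f := fun p : ℝ × X =>
      ENNReal.ofReal (K p.1 p.2) * lowerSlope g n p.2)
      (hKmeas.ennreal_ofReal.mul ((hslope n).comp measurable_snd))
  have hrmono : Monotone r := fun m n hmn s => by
    refine lintegral_mono fun τ => ?_
    dsimp only
    gcongr
    exact monotone_lowerSlope g hmn τ
  have hL := lintegral_lintegral_mul_exp (μ := μ) hFm hFnn
  have hkint : ∫⁻ s, k s = ENNReal.ofReal (∫ τ, (∫ s, K s τ * g' τ) ∂μ) := by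
    rw [ofReal_integral_integral_eq_lintegral_prod hχ0int hFnn]
    simpa using hL 0
  obtain ⟨n, hn⟩ := exists_forall_supersolution_false hk (q := q)
    (by rw [hkint]; exact ENNReal.ofReal_ne_top) (by rw [hkint]; simpa using hχ0)
    (fun z hz h1 => by
      have hi : Integrable (fun p : ℝ × X => K p.1 p.2 * g' p.2 * Real.exp (-(p.1 * z)))
          ((volume : Measure ℝ).prod μ) := by
        refine (lintegral_ofReal_ne_top_iff_integrable
          (Measurable.aestronglyMeasurable (by fun_prop))
          (Eventually.of_forall fun p => mul_nonneg (hFnn _ _) (Real.exp_nonneg _))).1 ?_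
        rw [← hL z, h1]
        exact ENNReal.one_ne_top
      refine hχ z hz hi ?_
      rw [← ENNReal.ofReal_eq_one, ofReal_integral_integral_eq_lintegral_prod
        (F := fun s τ => K s τ * g' τ * Real.exp (-(s * z))) hi
        (fun s τ => mul_nonneg (hFnn _ _) (Real.exp_nonneg _)), ← hL z, h1])
    (fun n => (hr n).indicator Metric.isClosed_closedBall.measurableSet)
    (fun m n hmn s => by
      refine (indicator_le_indicator (hrmono hmn s)).trans
        (indicator_le_indicator_of_subset (Metric.closedBall_subset_closedBall ?_)
          (fun _ => zero_le) s)
      exact_mod_cast hmn)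
    (fun n s hs => indicator_of_notMem (by simpa using hs) _)
    (fun s => by
      have hKs : Measurable fun τ => ENNReal.ofReal (K s τ) :=
        (hKmeas.comp (by fun_prop : Measurable fun τ : X => (s, τ))).ennreal_ofReal
      calc k s ≤ ∫⁻ τ, ⨆ n, ENNReal.ofReal (K s τ) * lowerSlope g n τ ∂μ := by
            refine lintegral_mono fun τ => ?_
            rw [← ENNReal.mul_iSup, ENNReal.ofReal_mul (hKnn s τ)]
            gcongr
            exact le_iSup_lowerSlope (hg'lim τ)
        _ = ⨆ n, r n s := lintegral_iSup (fun n => hKs.mul (hslope n)) fun m n hmn τ => by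
            dsimp only
            gcongr
            exact monotone_lowerSlope g hmn τ
        _ ≤ ⨆ n, q n s := by
            refine iSup_le fun m => ?_
            obtain ⟨j, hj⟩ := exists_nat_ge |s|
            refine le_iSup_of_le (max m j) ?_
            have hmem : s ∈ Metric.closedBall (0 : ℝ) (max m j : ℕ) := by
              rw [Metric.mem_closedBall, Real.dist_eq, sub_zero]
              exact hj.trans (by exact_mod_cast le_max_right m j)
            simp only [q, indicator_of_mem hmem]
            exact hrmono (le_max_left _ _) s)
  obtain ⟨ψ, hψc, hψpos, hψM, hψeq, hψe⟩ := h.exists_pos_solution_le hgcont hP hφc hφpos hM hφeq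
    hlow (e := 1 / ((n : ℝ) + 2)) (by positivity)
  have hψm := hψc.measurable
  refine hn (fun t => ENNReal.ofReal (ψ (t - (n + 1)))) (by fun_prop)
    (fun t => ENNReal.ofReal_pos.2 (hψpos _))
    ⟨ENNReal.ofReal M, ENNReal.ofReal_ne_top, fun t _ => ENNReal.ofReal_le_ofReal (hψM _)⟩
    fun t ht => ?_
  have := h.lintegral_lowerSlope_le hgcont hψm hψpos hψM hψeq (n := n) (t := t - (n + 1))
    fun s hs => by
      refine (hψe _ (by linarith [(abs_le.1 hs).1])).trans_lt ?_
      gcongr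
      norm_num
  simpa only [sub_right_comm] using this

theorem integral_integral_comp_neg_left {X : Type*} [MeasurableSpace X] (μ : Measure X)
    (F : ℝ → X → ℝ) : ∫ τ, (∫ s, F (-s) τ) ∂μ = ∫ τ, (∫ s, F s τ) ∂μ :=
  integral_congr_ae (Eventually.of_forall fun τ => integral_neg_eq_self (fun s => F s τ) volume)

theorem MeasureTheory.Integrable.comp_neg_fst {X : Type*} [MeasurableSpace X] {μ : Measure X}
    [SFinite μ] {F : ℝ × X → ℝ} (hF : Integrable F ((volume : Measure ℝ).prod μ)) :
    Integrable (fun p : ℝ × X => F (-p.1, p.2)) ((volume : Measure ℝ).prod μ) :=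
  (((Measure.measurePreserving_neg (volume : Measure ℝ)).prod
    (MeasurePreserving.id μ)).integrable_comp hF.aestronglyMeasurable).2 hF

theorem integral_integral_le_one_of_exp {X : Type*} [MeasurableSpace X] {μ : Measure X}
    [SFinite μ] {F : ℝ → X → ℝ} (hFnn : ∀ s τ, 0 ≤ F s τ)
    (hF : Integrable (fun p : ℝ × X => F p.1 p.2) ((volume : Measure ℝ).prod μ)) {y z : ℝ}
    (hy : y < 0) (hz : 0 < z)
    (hyi : Integrable (fun p : ℝ × X => F p.1 p.2 * Real.exp (-(p.1 * y)))
      ((volume : Measure ℝ).prod μ))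
    (hzi : Integrable (fun p : ℝ × X => F p.1 p.2 * Real.exp (-(p.1 * z)))
      ((volume : Measure ℝ).prod μ))
    (hy1 : (∫ τ, (∫ s, F s τ * Real.exp (-(s * y))) ∂μ) = 1)
    (hz1 : (∫ τ, (∫ s, F s τ * Real.exp (-(s * z))) ∂μ) = 1) :
    (∫ τ, (∫ s, F s τ) ∂μ) ≤ 1 := by
  rw [← integral_prod_symm (fun p : ℝ × X => F p.1 p.2 * Real.exp (-(p.1 * y))) hyi] at hy1
  rw [← integral_prod_symm (fun p : ℝ × X => F p.1 p.2 * Real.exp (-(p.1 * z))) hzi] at hz1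
  rw [← integral_prod_symm (fun p : ℝ × X => F p.1 p.2) hF]
  have hzy : 0 < z - y := by linarith
  calc ∫ p : ℝ × X, F p.1 p.2 ∂(volume.prod μ)
      ≤ ∫ p : ℝ × X, (z / (z - y) * (F p.1 p.2 * Real.exp (-(p.1 * y))) +
          -y / (z - y) * (F p.1 p.2 * Real.exp (-(p.1 * z)))) ∂(volume.prod μ) := by
        refine integral_mono hF ((hyi.const_mul _).add (hzi.const_mul _)) fun p => ?_
        have hconv := convexOn_exp.2 (mem_univ (-(p.1 * y))) (mem_univ (-(p.1 * z)))
          (show 0 ≤ z / (z - y) by positivity)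
          (show 0 ≤ -y / (z - y) from div_nonneg (by linarith) hzy.le)
          (by field_simp; ring)
        have h0 : z / (z - y) * -(p.1 * y) + -y / (z - y) * -(p.1 * z) = 0 := by
          field_simp
          ring
        simp only [smul_eq_mul, h0, Real.exp_zero] at hconv
        calc F p.1 p.2 = F p.1 p.2 * 1 := (mul_one _).symm
          _ ≤ F p.1 p.2 * _ := mul_le_mul_of_nonneg_left hconv (hFnn _ _)
          _ = _ := by ring
    _ = 1 := by
        rw [integral_add (hyi.const_mul _) (hzi.const_mul _), integral_const_mul,
          integral_const_mul, hy1, hz1]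
        field_simp
        ring

theorem stmt3
    {X : Type*} [MeasurableSpace X] (μ : Measure X) [IsFiniteMeasure μ]
    (K : ℝ → X → ℝ) (g : ℝ → X → ℝ)
    (hKmeas : Measurable fun p : ℝ × X => K p.1 p.2)
    (hKnn : ∀ s τ, 0 ≤ K s τ)
    (hKint : Integrable (fun p : ℝ × X => K p.1 p.2) ((volume : Measure ℝ).prod μ))
    (hKpos : ∀ τ, 0 < ∫ s, K s τ)
    (hgmeas : Measurable fun p : ℝ × X => g p.1 p.2)
    (hg0 : ∀ τ, g 0 τ = 0)
    (hgnn : ∀ u τ, 0 ≤ u → 0 ≤ g u τ)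
    (hgcont : ∀ τ, ContinuousOn (fun u => g u τ) (Ici 0))
    (g' : X → ℝ) (hg'meas : Measurable g') (hg'pos : ∀ τ, 0 < g' τ)
    (hg'lim : ∀ τ, Tendsto (fun u => g u τ / u) (𝓝[>] 0) (𝓝 (g' τ)))
    (hC : ∀ δ : ℝ, 0 < δ → ∃ Cd : X → ℝ, Measurable Cd ∧ (∀ τ, 0 ≤ Cd τ) ∧
      (∀ τ, ∀ u ∈ Icc (0:ℝ) δ, g u τ ≤ Cd τ * u) ∧
      Integrable (fun τ => Cd τ * ∫ s, K s τ) μ)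
    (hP : ∀ ψ : ℝ → ℝ, Continuous ψ → (∀ t, 0 ≤ ψ t) → (∃ M, ∀ t, ψ t ≤ M) →
      (∀ t, ψ t = ∫ τ, (∫ s, K s τ * g (ψ (t - s)) τ) ∂μ) →
      (∃ t0, ψ t0 = 0) → ∀ t, ψ t = 0)
    (hχ0int : Integrable (fun p : ℝ × X => K p.1 p.2 * g' p.2) ((volume : Measure ℝ).prod μ))
    (hχ0 : 1 < ∫ τ, (∫ s, K s τ * g' τ) ∂μ)
    (φ : ℝ → ℝ) (hφc : Continuous φ)
    (hφpos : ∀ t, 0 < φ t)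
    (hφbd : ∃ M, ∀ t, φ t ≤ M)
    (hφeq : ∀ t, φ t = ∫ τ, (∫ s, K s τ * g (φ (t - s)) τ) ∂μ)
    :
    ((∀ z : ℝ, 0 < z → (Integrable (fun p : ℝ × X => K p.1 p.2 * g' p.2 * Real.exp (-(p.1 * z))) ((volume : Measure ℝ).prod μ)) → (∫ τ, (∫ s, K s τ * g' τ * Real.exp (-(s * z))) ∂μ) ≠ 1) →
      0 < liminf φ atBot) ∧
    ((∀ z : ℝ, z < 0 → (Integrable (fun p : ℝ × X => K p.1 p.2 * g' p.2 * Real.exp (-(p.1 * z))) ((volume : Measure ℝ).prod μ)) → (∫ τ, (∫ s, K s τ * g' τ * Real.exp (-(s * z))) ∂μ) ≠ 1) →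
      0 < liminf φ atTop) ∧
    ¬(Tendsto φ atBot (𝓝 0) ∧ Tendsto φ atTop (𝓝 0)) := by
  have hrefl : ∀ ψ : ℝ → ℝ, ∀ t, (∫ τ, (∫ s, K (-s) τ * g (ψ (-(t - s))) τ) ∂μ) =
      ∫ τ, (∫ s, K s τ * g (ψ (-t - s)) τ) ∂μ := fun ψ t => by
    rw [← integral_integral_comp_neg_left μ fun s τ => K s τ * g (ψ (-t - s)) τ]
    simp only [neg_sub, sub_neg_eq_add, neg_add_eq_sub]
  have hbot := liminf_atBot_pos_of_integral_exp_ne_one μ K g hKmeas hKnn hKpos hgmeas hgnn hgcont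
    g' hg'meas hg'pos hg'lim hC hP hχ0int hχ0 φ hφc hφpos hφbd hφeq
  have htop : (∀ z : ℝ, z < 0 → (Integrable (fun p : ℝ × X =>
        K p.1 p.2 * g' p.2 * Real.exp (-(p.1 * z))) ((volume : Measure ℝ).prod μ)) →
      (∫ τ, (∫ s, K s τ * g' τ * Real.exp (-(s * z))) ∂μ) ≠ 1) → 0 < liminf φ atTop := by
    intro hχ
    have hK : ∀ τ, ∫ s, K (-s) τ = ∫ s, K s τ := fun τ =>
      integral_neg_eq_self (fun s => K s τ) volume
    have key := liminf_atBot_pos_of_integral_exp_ne_one μ (fun s τ => K (-s) τ) g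
      (hKmeas.comp (by fun_prop : Measurable fun p : ℝ × X => (-p.1, p.2)))
      (fun s τ => hKnn _ _) (fun τ => (hK τ).symm ▸ hKpos τ) hgmeas hgnn hgcont
      g' hg'meas hg'pos hg'lim (by simpa only [hK] using hC)
      (fun ψ hψc hψnn ⟨M, hM⟩ hψeq ⟨t₀, ht₀⟩ t => by
        have := hP (fun t => ψ (-t)) (by fun_prop) (fun t => hψnn _) ⟨M, fun t => hM _⟩
          (fun t => by
            rw [hψeq (-t), ← integral_integral_comp_neg_left μ]
            simp only [neg_neg, neg_sub, sub_neg_eq_add, neg_add_eq_sub])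
          ⟨-t₀, by simpa using ht₀⟩ (-t)
        simpa using this)
      hχ0int.comp_neg_fst
      (by rwa [integral_integral_comp_neg_left μ fun s τ => K s τ * g' τ])
      (fun t => φ (-t)) (by fun_prop) (fun t => hφpos _) (hφbd.imp fun M hM t => hM _)
      (fun t => by rw [hrefl, ← hφeq])
      (fun z hz hi h1 => by
        refine hχ (-z) (neg_lt_zero.2 hz) ?_ ?_
        · simpa using hi.comp_neg_fst
        · rw [← integral_integral_comp_neg_left μ]
          simpa using h1)
    rwa [show liminf (fun t => φ (-t)) atBot = liminf φ atTop by
      rw [← Filter.map_neg_atBot]; rfl] at key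
  refine ⟨hbot, htop, fun ⟨h₁, h₂⟩ => ?_⟩
  have hz : ¬ 0 < liminf φ atBot := by rw [h₁.liminf_eq]; exact lt_irrefl 0
  have hy : ¬ 0 < liminf φ atTop := by rw [h₂.liminf_eq]; exact lt_irrefl 0
  have hz' := mt hbot hz
  have hy' := mt htop hy
  push Not at hz' hy'
  obtain ⟨z, hz0, hzi, hz1⟩ := hz'
  obtain ⟨y, hy0, hyi, hy1⟩ := hy'
  exact hχ0.not_ge (integral_integral_le_one_of_exp (F := fun s τ => K s τ * g' τ)
    (fun s τ => mul_nonneg (hKnn _ _) (hg'pos _).le) hχ0int hy0 hz0 hyi hzi hy1 hz1)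
end
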